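/- Let G be a countable discrete infinite amenable group, π : (X,G) → (Y,G) a factor map between G-systems, μ a G-invariant Borel probability measure on X, and 𝒰 a finite Borel cover of X. If μ = ∫_Ω μ_ω dm(ω) is the ergodic decomposition of μ, then Asc_μ^+(G,𝒰|Y) = ∫_Ω Asc_{μ_ω}^+(G,𝒰|Y) dm(ω). -/

import Mathlib

open MeasureTheory Filter Set

noncomputable section

namespace AscLocal

/-- Limit of a real sequence (a junk value if the sequence does not converge). -/
def limSeq (f : ℕ → ℝ) : ℝ := limUnder Filter.atTop f

variable {G X Y : Type*}

/-- `U` is a cover of the whole space. -/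
def IsCover (U : Finset (Set X)) : Prop := ⋃₀ (U : Set (Set X)) = Set.univ

/-- every member of `α` is contained in some member of `U` (`α ⪰ U`). -/
def Refines (α U : Finset (Set X)) : Prop := ∀ A ∈ α, ∃ B ∈ U, A ⊆ B

/-- `α` is a finite measurable partition of the space. -/
def IsMPartition [MeasurableSpace X] (α : Finset (Set X)) : Prop :=
  IsCover α ∧ (∀ A ∈ α, MeasurableSet A) ∧
    ∀ A ∈ α, ∀ B ∈ α, A ≠ B → Disjoint A B

/-- Følner sequence of a group. -/
def IsFolner [Group G] [DecidableEq G] (F : ℕ → Finset G) : Prop :=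
  (∀ n, (F n).Nonempty) ∧
    ∀ g : G, Tendsto (fun n =>
      ((((((F n).image fun h => g * h) \ F n) ∪ (F n \ ((F n).image fun h => g * h)))).card : ℝ)
        / ((F n).card : ℝ)) atTop (nhds 0)

/-- The join `⋁_{g ∈ S} g⁻¹ U` of the pullbacks of the cover `U` under the action `act`. -/
def coverDyn [DecidableEq G] (act : G → X → X) (U : Finset (Set X)) (S : Finset G) :
    Finset (Set X) := by
  classical
  exact (S.pi fun _ => U).image fun f => ⋂ g, ⋂ (h : g ∈ S), act g ⁻¹' f g h

/-- The join `⋁_{i ∈ S} T^{-i} U` for a single transformation `T`. -/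
def coverIt (T : X → X) (U : Finset (Set X)) (S : Finset ℕ) : Finset (Set X) := by
  classical
  exact (S.pi fun _ => U).image fun f => ⋂ i, ⋂ (h : i ∈ S), (T^[i]) ⁻¹' f i h

/-- join of two finite families of sets. -/
def joinP (α β : Finset (Set X)) : Finset (Set X) := by
  classical
  exact (α ×ˢ β).image fun p => p.1 ∩ p.2

/-- minimal number of members of `U` needed to cover `K`. -/
def covNum (U : Finset (Set X)) (K : Set X) : ℕ :=
  sInf {n | ∃ V : Finset (Set X), V ⊆ U ∧ V.card = n ∧ K ⊆ ⋃₀ (V : Set (Set X))}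

/-- `N(U|Y) = sup_y N(U | pr⁻¹ y)` for a factor map `pr : X → Y`. -/
def covNumRel (pr : X → Y) (U : Finset (Set X)) : ℕ :=
  sSup {n | ∃ y : Y, n = covNum U (pr ⁻¹' {y})}

/-- Shannon entropy of a finite partition. -/
def entPart [MeasurableSpace X] (μ : Measure X) (α : Finset (Set X)) : ℝ :=
  ∑ A ∈ α, Real.negMulLog (μ A).toReal

/-- entropy of a finite cover: infimum over finer partitions. -/
def entCov [MeasurableSpace X] (μ : Measure X) (U : Finset (Set X)) : ℝ :=
  sInf {h | ∃ α, IsMPartition (X := X) α ∧ Refines α U ∧ h = entPart μ α}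

/-- conditional entropy of a partition given the σ-algebra `pr⁻¹ ℬ(Y)`:
`H_μ(α|Y) = ∑_{A ∈ α} ∫ -E(1_A|pr⁻¹ ℬ(Y)) log E(1_A|pr⁻¹ ℬ(Y)) dμ`. -/
def condEntPart [MeasurableSpace X] [MeasurableSpace Y] (μ : Measure X) (pr : X → Y)
    (α : Finset (Set X)) : ℝ :=
  ∑ A ∈ α, ∫ x, Real.negMulLog
    ((μ[A.indicator (fun _ => (1 : ℝ)) | MeasurableSpace.comap pr ‹_›]) x) ∂μ

/-- conditional entropy of a cover given `pr⁻¹ ℬ(Y)`: infimum over finer partitions. -/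
def condEntCover [MeasurableSpace X] [MeasurableSpace Y] (μ : Measure X) (pr : X → Y)
    (U : Finset (Set X)) : ℝ :=
  sInf {h | ∃ α, IsMPartition (X := X) α ∧ Refines α U ∧ h = condEntPart μ pr α}

/-- the coefficient `c^A_S = ∫ x^{|S|} (1-x)^{|A|-|S|} dλ(x)`. -/
def coeff (lam : Measure ℝ) (A S : Finset G) : ℝ :=
  ∫ x, x ^ S.card * (1 - x) ^ (A.card - S.card) ∂lam

/-- `lam` is a symmetric probability measure on `[0,1]`. -/
def IsCoeffMeasure (lam : Measure ℝ) : Prop :=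
  IsProbabilityMeasure lam ∧ lam (Set.Icc (0 : ℝ) 1)ᶜ = 0 ∧
    lam.map (fun x => 1 - x) = lam

/-- the uniform system of coefficients `c^A_S = 2^{-|A|}`. -/
def unifCoeff (A _S : Finset G) : ℝ := (1 / 2) ^ A.card

/-- the finite family `{U 0, …, U (d-1)}` as a `Finset` of sets. -/
def ofFun {d : ℕ} (U : Fin d → Set X) : Finset (Set X) := by
  classical
  exact Finset.univ.image U

section GroupAsc

variable [Group G] [DecidableEq G]

/-- the sequence `n ↦ (1/|F_n|) ∑_{S ⊆ F_n} c^{F_n}_S H_μ(α_S|Y)`. -/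
def ascCondPartSeq [MeasurableSpace X] [MeasurableSpace Y] (μ : Measure X) (pr : X → Y)
    (c : Finset G → Finset G → ℝ) (act : G → X → X) (α : Finset (Set X))
    (F : ℕ → Finset G) (n : ℕ) : ℝ :=
  (1 / ((F n).card : ℝ)) *
    ∑ S ∈ (F n).powerset, c (F n) S * condEntPart μ pr (coverDyn act α S)

/-- `Asc_μ(G,α|Y)`. -/
def AscCondPart [MeasurableSpace X] [MeasurableSpace Y] (μ : Measure X) (pr : X → Y)
    (c : Finset G → Finset G → ℝ) (act : G → X → X) (α : Finset (Set X))
    (F : ℕ → Finset G) : ℝ :=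
  limSeq (ascCondPartSeq μ pr c act α F)

/-- `Asc_μ^-(G,U|Y)`. -/
def AscCondMinus [MeasurableSpace X] [MeasurableSpace Y] (μ : Measure X) (pr : X → Y)
    (c : Finset G → Finset G → ℝ) (act : G → X → X) (U : Finset (Set X))
    (F : ℕ → Finset G) : ℝ :=
  limSeq fun n => (1 / ((F n).card : ℝ)) *
    ∑ S ∈ (F n).powerset, c (F n) S * condEntCover μ pr (coverDyn act U S)

/-- `Asc_μ^+(G,U|Y)`. -/
def AscCondPlus [MeasurableSpace X] [MeasurableSpace Y] (μ : Measure X) (pr : X → Y)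
    (c : Finset G → Finset G → ℝ) (act : G → X → X) (U : Finset (Set X))
    (F : ℕ → Finset G) : ℝ :=
  sInf {h | ∃ α, IsMPartition (X := X) α ∧ Refines α U ∧ h = AscCondPart μ pr c act α F}

/-- `Asc_μ(G,X|Y) = sup_α Asc_μ(G,α|Y)`. -/
def AscCondSup [MeasurableSpace X] [MeasurableSpace Y] (μ : Measure X) (pr : X → Y)
    (c : Finset G → Finset G → ℝ) (act : G → X → X) (F : ℕ → Finset G) : ℝ :=
  sSup {h | ∃ α, IsMPartition (X := X) α ∧ h = AscCondPart μ pr c act α F}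

/-- unconditional `Asc_μ(G,α)`. -/
def AscPart [MeasurableSpace X] (μ : Measure X)
    (c : Finset G → Finset G → ℝ) (act : G → X → X) (α : Finset (Set X))
    (F : ℕ → Finset G) : ℝ :=
  limSeq fun n => (1 / ((F n).card : ℝ)) *
    ∑ S ∈ (F n).powerset, c (F n) S * entPart μ (coverDyn act α S)

/-- unconditional `Asc_μ^-(G,U)`. -/
def AscMinus [MeasurableSpace X] (μ : Measure X)
    (c : Finset G → Finset G → ℝ) (act : G → X → X) (U : Finset (Set X))
    (F : ℕ → Finset G) : ℝ :=
  limSeq fun n => (1 / ((F n).card : ℝ)) *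
    ∑ S ∈ (F n).powerset, c (F n) S * entCov μ (coverDyn act U S)

/-- unconditional `Asc_μ^+(G,U)`. -/
def AscPlus [MeasurableSpace X] (μ : Measure X)
    (c : Finset G → Finset G → ℝ) (act : G → X → X) (U : Finset (Set X))
    (F : ℕ → Finset G) : ℝ :=
  sInf {h | ∃ α, IsMPartition (X := X) α ∧ Refines α U ∧ h = AscPart μ c act α F}

/-- conditional topological average sample complexity `Asc_top(G,U|Y)`. -/
def AscTopRel (c : Finset G → Finset G → ℝ) (act : G → X → X) (pr : X → Y)
    (U : Finset (Set X)) (F : ℕ → Finset G) : ℝ :=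
  limSeq fun n => (1 / ((F n).card : ℝ)) *
    ∑ S ∈ (F n).powerset, c (F n) S * Real.log (covNumRel pr (coverDyn act U S))

/-- topological average sample complexity `Asc_top(G,U)`. -/
def AscTop (c : Finset G → Finset G → ℝ) (act : G → X → X)
    (U : Finset (Set X)) (F : ℕ → Finset G) : ℝ :=
  limSeq fun n => (1 / ((F n).card : ℝ)) *
    ∑ S ∈ (F n).powerset, c (F n) S * Real.log (covNum (coverDyn act U S) Set.univ)

/-- `ν` is `G`-invariant and ergodic for the action `act`. -/
def IsErgodicAct [MeasurableSpace X] (act : G → X → X) (ν : Measure X) : Prop :=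
  (∀ g, Measure.map (act g) ν = ν) ∧
    ∀ A : Set X, MeasurableSet A → (∀ g, act g ⁻¹' A = A) → ν A = 0 ∨ ν A = 1

end GroupAsc

/-- `Asc_μ(T,α|Y)` for a `ℤ`-system, uniform coefficients `2^{-n}`. -/
def zAscCondPart [MeasurableSpace X] [MeasurableSpace Y] (μ : Measure X) (pr : X → Y)
    (T : X → X) (α : Finset (Set X)) : ℝ :=
  limSeq fun n => (1 / (n : ℝ)) * ∑ S ∈ (Finset.range n).powerset,
    ((1 : ℝ) / 2) ^ n * condEntPart μ pr (coverIt T α S)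

/-- `Asc_μ^-(T,U|Y)` for a `ℤ`-system, uniform coefficients. -/
def zAscCondMinus [MeasurableSpace X] [MeasurableSpace Y] (μ : Measure X) (pr : X → Y)
    (T : X → X) (U : Finset (Set X)) : ℝ :=
  limSeq fun n => (1 / (n : ℝ)) * ∑ S ∈ (Finset.range n).powerset,
    ((1 : ℝ) / 2) ^ n * condEntCover μ pr (coverIt T U S)

/-- `Asc_μ^+(T,U|Y)` for a `ℤ`-system, uniform coefficients. -/
def zAscCondPlus [MeasurableSpace X] [MeasurableSpace Y] (μ : Measure X) (pr : X → Y)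
    (T : X → X) (U : Finset (Set X)) : ℝ :=
  sInf {h | ∃ α, IsMPartition (X := X) α ∧ Refines α U ∧ h = zAscCondPart μ pr T α}

/-- `Asc_top(T,U|Y)` for a `ℤ`-system, uniform coefficients. -/
def zAscTop (T : X → X) (pr : X → Y) (U : Finset (Set X)) : ℝ :=
  limSeq fun n => (1 / (n : ℝ)) * ∑ S ∈ (Finset.range n).powerset,
    ((1 : ℝ) / 2) ^ n * Real.log (covNumRel pr (coverIt T U S))

end AscLocal

open AscLocal

namespace AscPf

set_option linter.unusedSectionVars false

section Ent

variable {X ι κ τ : Type*} [MeasurableSpace X] [Fintype ι] [Fintype κ] [Fintype τ]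

def MF (p : X → ι) : Prop := ∀ i, MeasurableSet (p ⁻¹' {i})

def Hn (ν : Measure X) (p : X → ι) : ℝ := ∑ i, Real.negMulLog (ν.real (p ⁻¹' {i}))

def Hc (ν : Measure X) (p : X → ι) (y : X → κ) : ℝ := Hn ν (fun x => (p x, y x)) - Hn ν y

lemma MF.pair {p : X → ι} {y : X → κ} (hp : MF p) (hy : MF y) : MF (fun x => (p x, y x)) := by
  rintro ⟨i, k⟩
  have : (fun x => (p x, y x)) ⁻¹' {(i, k)} = p ⁻¹' {i} ∩ y ⁻¹' {k} := by
    ext x; simp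
  rw [this]; exact (hp i).inter (hy k)

lemma MF.preimage {p : X → ι} (hp : MF p) (s : Set ι) : MeasurableSet (p ⁻¹' s) := by
  have : p ⁻¹' s = ⋃ i ∈ s, p ⁻¹' {i} := by ext x; simp
  rw [this]
  exact MeasurableSet.biUnion (Set.toFinite s).countable (fun i _ => hp i)

lemma MF.map {p : X → ι} (hp : MF p) (r : ι → κ) : MF (fun x => r (p x)) := by
  intro k
  exact hp.preimage (r ⁻¹' {k})

lemma real_preimage (ν : Measure X) [IsFiniteMeasure ν] {p : X → ι} (hp : MF p) (r : ι → κ)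
    (B : Set X) (hB : MeasurableSet B) [DecidableEq κ] (k : κ) :
    ν.real ((fun x => r (p x)) ⁻¹' {k} ∩ B) = ∑ i with r i = k, ν.real (p ⁻¹' {i} ∩ B) := by
  have : (fun x => r (p x)) ⁻¹' {k} ∩ B = ⋃ i ∈ Finset.univ.filter (fun i => r i = k), p ⁻¹' {i} ∩ B := by
    ext x; simp
  rw [this, measureReal_biUnion_finset]
  · intro i _ j _ hij
    rw [Function.onFun, Set.disjoint_left]
    rintro x ⟨hx, _⟩ ⟨hx', _⟩
    exact hij (hx.symm.trans hx')
  · intro i _; exact (hp i).inter hB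

lemma nml_sum_le {s : Finset ι} {a : ι → ℝ} (ha : ∀ i ∈ s, 0 ≤ a i) :
    Real.negMulLog (∑ i ∈ s, a i) ≤ ∑ i ∈ s, Real.negMulLog (a i) := by
  have h1 : Real.negMulLog (∑ i ∈ s, a i) = ∑ i ∈ s, (- a i * Real.log (∑ i ∈ s, a i)) := by
    rw [Real.negMulLog, ← Finset.sum_mul, Finset.sum_neg_distrib]
  rw [h1]
  apply Finset.sum_le_sum
  intro i hi
  rcases (ha i hi).eq_or_lt with h | h
  · simp [← h]
  · rw [Real.negMulLog]
    have : Real.log (a i) ≤ Real.log (∑ i ∈ s, a i) :=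
      Real.log_le_log h (Finset.single_le_sum ha hi)
    nlinarith

lemma Hn_map_le (ν : Measure X) [IsFiniteMeasure ν] {p : X → ι} (hp : MF p) (r : ι → κ) :
    Hn ν (fun x => r (p x)) ≤ Hn ν p := by
  classical
  unfold Hn
  have h1 : ∀ k, Real.negMulLog (ν.real ((fun x => r (p x)) ⁻¹' {k})) ≤
      ∑ i with r i = k, Real.negMulLog (ν.real (p ⁻¹' {i})) := by
    intro k
    have := real_preimage ν hp r univ MeasurableSet.univ k
    simp only [inter_univ] at this
    rw [this]
    exact nml_sum_le (fun i _ => measureReal_nonneg)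
  refine (Finset.sum_le_sum (fun k _ => h1 k)).trans (le_of_eq ?_)
  exact Finset.sum_fiberwise _ _ _

/-- two-variable submodularity -/
lemma submod2 (a : ι → κ → ℝ) (ha : ∀ i j, 0 ≤ a i j) :
    ∑ i, ∑ j, Real.negMulLog (a i j) + Real.negMulLog (∑ i, ∑ j, a i j) ≤
      ∑ i, Real.negMulLog (∑ j, a i j) + ∑ j, Real.negMulLog (∑ i, a i j) := by
  set T := ∑ i, ∑ j, a i j with hT
  have hT' : T = ∑ j, ∑ i, a i j := by rw [hT, Finset.sum_comm]
  set R : ι → ℝ := fun i => ∑ j, a i j with hR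
  set C : κ → ℝ := fun j => ∑ i, a i j with hC
  have hR0 : ∀ i, 0 ≤ R i := fun i => Finset.sum_nonneg fun j _ => ha i j
  have hC0 : ∀ j, 0 ≤ C j := fun j => Finset.sum_nonneg fun i _ => ha i j
  have hT0 : 0 ≤ T := Finset.sum_nonneg fun i _ => hR0 i
  have e1 : Real.negMulLog T = ∑ i, ∑ j, (- a i j * Real.log T) := by
    rw [Real.negMulLog]; simp only [← Finset.sum_mul, Finset.sum_neg_distrib]; rw [hT]
  have e2 : ∑ i, Real.negMulLog (R i) = ∑ i, ∑ j, (- a i j * Real.log (R i)) := by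
    simp only [Real.negMulLog, ← Finset.sum_mul, Finset.sum_neg_distrib, hR]
  have e3 : ∑ j, Real.negMulLog (C j) = ∑ i, ∑ j, (- a i j * Real.log (C j)) := by
    rw [Finset.sum_comm]
    simp only [Real.negMulLog, ← Finset.sum_mul, Finset.sum_neg_distrib, hC]
  change _ ≤ ∑ i, Real.negMulLog (R i) + ∑ j, Real.negMulLog (C j)
  rw [e1, e2, e3]
  simp only [← Finset.sum_add_distrib]
  rcases hT0.eq_or_lt with h0 | hTpos
  · have : ∀ i j, a i j = 0 := by
      intro i j
      have h2 : R i = 0 := (Finset.sum_eq_zero_iff_of_nonneg (fun i _ => hR0 i)).1 h0.symm i (Finset.mem_univ _)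
      exact (Finset.sum_eq_zero_iff_of_nonneg (fun j _ => ha i j)).1 h2 j (Finset.mem_univ _)
    simp [this]
  have key : ∀ i j, Real.negMulLog (a i j) + - a i j * Real.log T ≤
      (- a i j * Real.log (R i) + - a i j * Real.log (C j)) + (R i * C j / T - a i j) := by
    intro i j
    rcases (ha i j).eq_or_lt with h | h
    · rw [← h]; simp
      exact div_nonneg (mul_nonneg (hR0 i) (hC0 j)) hT0
    · have hRp : 0 < R i := h.trans_le (Finset.single_le_sum (fun j _ => ha i j) (Finset.mem_univ j))
      have hCp : 0 < C j := h.trans_le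
        (Finset.single_le_sum (f := fun i => a i j) (fun i _ => ha i j) (Finset.mem_univ i))
      have hl := Real.log_le_sub_one_of_pos (x := R i * C j / (a i j * T)) (by positivity)
      rw [Real.log_div (by positivity) (by positivity), Real.log_mul hRp.ne' hCp.ne',
        Real.log_mul h.ne' hTpos.ne'] at hl
      have h3 := mul_le_mul_of_nonneg_left hl h.le
      have h4 : a i j * (R i * C j / (a i j * T) - 1) = R i * C j / T - a i j := by
        field_simp
      rw [h4] at h3
      rw [Real.negMulLog]; linarith
  refine (Finset.sum_le_sum fun i _ => Finset.sum_le_sum fun j _ => key i j).trans (le_of_eq ?_)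
  have h5 : ∑ i, ∑ j, (R i * C j / T - a i j) = 0 := by
    simp only [Finset.sum_sub_distrib]
    rw [← hT]
    simp only [← Finset.sum_div, ← Finset.mul_sum, ← Finset.sum_mul]
    rw [← hT', ← hT]; field_simp; simp
  simp only [Finset.sum_add_distrib] at *
  linarith

lemma marg (ν : Measure X) [IsFiniteMeasure ν] {p : X → ι} (hp : MF p)
    (B : Set X) (hB : MeasurableSet B) :
    ν.real B = ∑ i, ν.real (p ⁻¹' {i} ∩ B) := by
  classical
  have := real_preimage ν hp (fun _ => ()) B hB ()
  simp at this
  rw [← this]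

lemma Hn_submod (ν : Measure X) [IsFiniteMeasure ν] {p : X → ι} {q : X → κ} {y : X → τ}
    (hp : MF p) (hq : MF q) (hy : MF y) :
    Hn ν (fun x => (p x, q x, y x)) + Hn ν y ≤
      Hn ν (fun x => (p x, y x)) + Hn ν (fun x => (q x, y x)) := by
  unfold Hn
  simp only [Fintype.sum_prod_type]
  rw [Finset.sum_congr rfl (fun i _ => Finset.sum_comm), Finset.sum_comm,
    Finset.sum_comm (f := fun i k => Real.negMulLog (ν.real ((fun x => (p x, y x)) ⁻¹' {(i,k)}))),
    Finset.sum_comm (f := fun i k => Real.negMulLog (ν.real ((fun x => (q x, y x)) ⁻¹' {(i,k)}))),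
    ← Finset.sum_add_distrib, ← Finset.sum_add_distrib]
  apply Finset.sum_le_sum
  intro k _
  have h := submod2 (fun i j => ν.real ((fun x => (p x, q x, y x)) ⁻¹' {(i, j, k)}))
    (fun _ _ => measureReal_nonneg)
  have e1 : ∀ i, ∑ j, ν.real ((fun x => (p x, q x, y x)) ⁻¹' {(i, j, k)}) =
      ν.real ((fun x => (p x, y x)) ⁻¹' {(i,k)}) := by
    intro i
    rw [marg ν hq _ (hp.pair hy (i,k))]
    refine Finset.sum_congr rfl fun j _ => ?_
    congr 1; ext x; simp; tauto
  have e2 : ∀ j, ∑ i, ν.real ((fun x => (p x, q x, y x)) ⁻¹' {(i, j, k)}) =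
      ν.real ((fun x => (q x, y x)) ⁻¹' {(j,k)}) := by
    intro j
    rw [marg ν hp _ (hq.pair hy (j,k))]
    refine Finset.sum_congr rfl fun j _ => ?_
    congr 1; ext x; simp
  have e3 : ∑ i, ν.real ((fun x => (p x, y x)) ⁻¹' {(i,k)}) = ν.real (y ⁻¹' {k}) := by
    rw [marg ν hp _ (hy k)]
    refine Finset.sum_congr rfl fun j _ => ?_
    congr 1; ext x; simp
  simp only [e1, e2, e3] at h
  exact h

lemma Hc_nonneg (ν : Measure X) [IsFiniteMeasure ν] {p : X → ι} {y : X → κ} (hp : MF p)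
    (hy : MF y) : 0 ≤ Hc ν p y :=
  sub_nonneg.2 (Hn_map_le ν (hp.pair hy) Prod.snd)

lemma Hc_map_le (ν : Measure X) [IsFiniteMeasure ν] {p : X → ι} {y : X → κ} (hp : MF p)
    (hy : MF y) (r : ι → τ) : Hc ν (fun x => r (p x)) y ≤ Hc ν p y :=
  sub_le_sub_right (Hn_map_le ν (hp.pair hy) (fun z => (r z.1, z.2))) _

lemma Hc_anti (ν : Measure X) [IsFiniteMeasure ν] {p : X → ι} {y : X → κ} (hp : MF p)
    (hy : MF y) (r : κ → τ) : Hc ν p y ≤ Hc ν p (fun x => r (y x)) := by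
  have h1 := Hn_submod ν hp hy (hy.map r)
  have h2 := Hn_map_le ν (hp.pair (hy.pair (hy.map r))) (fun z => (z.1, z.2.1))
  have h3 := Hn_map_le ν hy (fun k => (k, r k))
  unfold Hc
  simp only at *
  linarith

lemma Hc_submod (ν : Measure X) [IsFiniteMeasure ν] {p : X → ι} {q : X → κ} {y : X → τ}
    (hp : MF p) (hq : MF q) (hy : MF y) {σ : Type*} [Fintype σ] {z : X → σ} (hz : MF z) :
    Hc ν (fun x => (p x, q x, z x)) y + Hc ν z y ≤
      Hc ν (fun x => (p x, z x)) y + Hc ν (fun x => (q x, z x)) y := by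
  have h1 := Hn_submod ν hp hq (hz.pair hy)
  have h2 := Hn_map_le ν (hp.pair (hq.pair (hz.pair hy))) (fun w => ((w.1, w.2.1, w.2.2.1), w.2.2.2))
  have h3 := Hn_map_le ν ((hp.pair hz).pair hy) (fun w => (w.1.1, w.1.2, w.2))
  have h4 := Hn_map_le ν ((hq.pair hz).pair hy) (fun w => (w.1.1, w.1.2, w.2))
  unfold Hc
  simp only at *
  linarith

lemma nml_le_one {x : ℝ} (h0 : 0 ≤ x) : Real.negMulLog x ≤ 1 := by
  rcases h0.eq_or_lt with h | h
  · simp [← h]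
  · have := Real.one_sub_inv_le_log_of_pos h
    have h2 := mul_le_mul_of_nonneg_left this h.le
    rw [mul_sub, mul_inv_cancel₀ h.ne'] at h2
    rw [Real.negMulLog]; linarith

lemma Hn_nonneg (ν : Measure X) [IsProbabilityMeasure ν] (p : X → ι) : 0 ≤ Hn ν p :=
  Finset.sum_nonneg fun _ _ => Real.negMulLog_nonneg measureReal_nonneg measureReal_le_one

lemma Hn_le (ν : Measure X) (p : X → ι) : Hn ν p ≤ Fintype.card ι := by
  unfold Hn
  refine (Finset.sum_le_sum fun i _ => nml_le_one measureReal_nonneg).trans ?_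
  simp

lemma Hc_le (ν : Measure X) [IsProbabilityMeasure ν] (p : X → ι) (y : X → κ) :
    Hc ν p y ≤ Fintype.card (ι × κ) := by
  have := Hn_le ν (fun x => (p x, y x))
  have := Hn_nonneg ν y
  unfold Hc; linarith

lemma Hn_congr (ν : Measure X) {p q : X → ι} (h : p =ᵐ[ν] q) : Hn ν p = Hn ν q := by
  unfold Hn
  refine Finset.sum_congr rfl fun i _ => ?_
  congr 1
  apply measureReal_congr
  filter_upwards [h] with x hx
  change (p x = i) = (q x = i)
  rw [hx]

lemma Hc_congr (ν : Measure X) {p q : X → ι} (y : X → κ) (h : p =ᵐ[ν] q) :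
    Hc ν p y = Hc ν q y := by
  unfold Hc
  rw [Hn_congr ν (p := fun x => (p x, y x)) (q := fun x => (q x, y x))]
  filter_upwards [h] with x hx
  rw [hx]

lemma Hc_expand (ν : Measure X) [IsFiniteMeasure ν] {p : X → ι} {y : X → κ} (hp : MF p)
    (hy : MF y) : Hc ν p y = ∑ i, ∑ k, (Real.negMulLog (ν.real (p ⁻¹' {i} ∩ y ⁻¹' {k})) +
      ν.real (p ⁻¹' {i} ∩ y ⁻¹' {k}) * Real.log (ν.real (y ⁻¹' {k}))) := by
  unfold Hc Hn
  simp only [Fintype.sum_prod_type, Finset.sum_add_distrib]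
  rw [sub_eq_add_neg]
  congr 1
  · refine Finset.sum_congr rfl fun i _ => Finset.sum_congr rfl fun k _ => ?_
    congr 2; ext x; simp
  · rw [Finset.sum_comm, ← Finset.sum_neg_distrib]
    refine Finset.sum_congr rfl fun k _ => ?_
    rw [← Finset.sum_mul, ← marg ν hp _ (hy k), Real.negMulLog]; ring

end Ent

end AscPf

namespace AscPf

section Conc

variable {X ι κ τ : Type*} [MeasurableSpace X] [Fintype ι] [Fintype κ] [Fintype τ]

lemma abs_mul_log_le {a b : ℝ} (ha : 0 ≤ a) (hab : a ≤ b) (hb : b ≤ 1) : |a * Real.log b| ≤ 1 := by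
  have hb0 := ha.trans hab
  have h1 : Real.log b ≤ 0 := Real.log_nonpos hb0 hb
  have h2 := nml_le_one hb0
  rw [Real.negMulLog] at h2
  rw [abs_le]
  constructor <;> nlinarith

lemma concave_term {Ω : Type*} [MeasurableSpace Ω] (m : Measure Ω) [IsProbabilityMeasure m]
    {a b : Ω → ℝ} (ham : Measurable a) (hbm : Measurable b) (ha : ∀ ω, 0 ≤ a ω)
    (hab : ∀ ω, a ω ≤ b ω) (hb : ∀ ω, b ω ≤ 1) :
    Integrable (fun ω => Real.negMulLog (a ω) + a ω * Real.log (b ω)) m ∧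
    ∫ ω, (Real.negMulLog (a ω) + a ω * Real.log (b ω)) ∂m ≤
      Real.negMulLog (∫ ω, a ω ∂m) + (∫ ω, a ω ∂m) * Real.log (∫ ω, b ω ∂m) := by
  have ia : Integrable a m := Integrable.of_bound (C := 1) ham.aestronglyMeasurable
    (Eventually.of_forall fun ω => by rw [Real.norm_of_nonneg (ha ω)]; exact (hab ω).trans (hb ω))
  have ib : Integrable b m := Integrable.of_bound (C := 1) hbm.aestronglyMeasurable
    (Eventually.of_forall fun ω => by
      rw [Real.norm_of_nonneg ((ha ω).trans (hab ω))]; exact (hb ω))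
  have iF : Integrable (fun ω => Real.negMulLog (a ω) + a ω * Real.log (b ω)) m := by
    refine Integrable.of_bound (C := 2) ?_ (Eventually.of_forall fun ω => ?_)
    · exact ((Real.continuous_negMulLog.measurable.comp ham).add
        (ham.mul (Real.measurable_log.comp hbm))).aestronglyMeasurable
    · have h1 := abs_mul_log_le (ha ω) (hab ω) (hb ω)
      have h2 := nml_le_one (ha ω)
      have h3 := Real.negMulLog_nonneg (ha ω) ((hab ω).trans (hb ω))
      rw [Real.norm_eq_abs]
      rw [abs_le] at *
      constructor <;> linarith
  refine ⟨iF, ?_⟩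
  set A := ∫ ω, a ω ∂m with hA
  set B := ∫ ω, b ω ∂m with hB
  have hA0 : 0 ≤ A := integral_nonneg ha
  rcases hA0.eq_or_lt with h | h
  · have : a =ᵐ[m] 0 := (integral_eq_zero_iff_of_nonneg ha ia).1 h.symm
    have h2 : (fun ω => Real.negMulLog (a ω) + a ω * Real.log (b ω)) =ᵐ[m] fun _ => 0 := by
      filter_upwards [this] with ω hω
      simp [hω]
    rw [integral_congr_ae h2, ← h]; simp
  · have hBA : A ≤ B := integral_mono ia ib hab
    have hB0 : 0 < B := h.trans_le hBA
    have key : ∀ ω, Real.negMulLog (a ω) + a ω * Real.log (b ω) ≤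
        - Real.log (A / B) * a ω + ((A / B) * b ω - a ω) := by
      intro ω
      rcases (ha ω).eq_or_lt with h' | h'
      · rw [← h']; simp
        exact mul_nonneg (by positivity) ((ha ω).trans (hab ω))
      · have hbp := h'.trans_le (hab ω)
        have hl := Real.log_le_sub_one_of_pos (x := (A / B) * b ω / a ω) (by positivity)
        rw [Real.log_div (by positivity) (by positivity), Real.log_mul (by positivity) hbp.ne'] at hl
        have h3 := mul_le_mul_of_nonneg_left hl h'.le
        have h4 : a ω * ((A / B) * b ω / a ω - 1) = (A / B) * b ω - a ω := by
          field_simp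
        rw [h4] at h3
        rw [Real.negMulLog]; linarith
    refine (integral_mono iF ?_ key).trans (le_of_eq ?_)
    · exact (ia.const_mul _).add ((ib.const_mul _).sub ia)
    · rw [integral_add (f := fun ω => - Real.log (A / B) * a ω)
        (g := fun ω => (A / B) * b ω - a ω) (ia.const_mul _) ((ib.const_mul _).sub ia),
        integral_sub (ib.const_mul _) ia, integral_const_mul, integral_const_mul, ← hA, ← hB,
        Real.log_div h.ne' hB0.ne', Real.negMulLog]
      field_simp
      ring

structure Dis {Ω : Type*} [MeasurableSpace Ω] (m : Measure Ω) (μ : Measure X)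
    (μω : Ω → Measure X) : Prop where
  hm : IsProbabilityMeasure m
  hμ : IsProbabilityMeasure μ
  hprob : ∀ ω, IsProbabilityMeasure (μω ω)
  hmeas : ∀ B : Set X, MeasurableSet B → Measurable fun ω => μω ω B
  hdis : ∀ B : Set X, MeasurableSet B → μ B = ∫⁻ ω, μω ω B ∂m

variable {Ω : Type*} [MeasurableSpace Ω] {m : Measure Ω} {μ : Measure X} {μω : Ω → Measure X}

lemma Dis.meas_real (D : Dis m μ μω) {B : Set X} (hB : MeasurableSet B) :
    Measurable fun ω => (μω ω).real B := (D.hmeas B hB).ennreal_toReal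

lemma Dis.real_eq (D : Dis m μ μω) {B : Set X} (hB : MeasurableSet B) :
    μ.real B = ∫ ω, (μω ω).real B ∂m := by
  have := D.hprob
  rw [Measure.real, D.hdis B hB]
  rw [← integral_toReal (D.hmeas B hB).aemeasurable]
  · rfl
  · exact Eventually.of_forall fun ω => measure_lt_top _ _

lemma Dis.meas_Hn (D : Dis m μ μω) {p : X → ι} (hp : MF p) :
    Measurable fun ω => Hn (μω ω) p := by
  unfold Hn
  exact Finset.measurable_sum _ fun i _ =>
    Real.continuous_negMulLog.measurable.comp (D.meas_real (hp i))

lemma Dis.meas_Hc (D : Dis m μ μω) {p : X → ι} {y : X → κ} (hp : MF p) (hy : MF y) :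
    Measurable fun ω => Hc (μω ω) p y :=
  (D.meas_Hn (hp.pair hy)).sub (D.meas_Hn hy)

lemma Dis.int_Hc (D : Dis m μ μω) {p : X → ι} {y : X → κ} (hp : MF p) (hy : MF y) :
    Integrable (fun ω => Hc (μω ω) p y) m := by
  have := D.hm
  have := D.hprob
  refine Integrable.of_bound (C := Fintype.card (ι × κ)) (D.meas_Hc hp hy).aestronglyMeasurable
    (Eventually.of_forall fun ω => ?_)
  rw [Real.norm_of_nonneg (Hc_nonneg _ hp hy)]
  exact Hc_le _ _ _

lemma Dis.Hc_concave (D : Dis m μ μω) {p : X → ι} {y : X → κ} (hp : MF p) (hy : MF y) :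
    ∫ ω, Hc (μω ω) p y ∂m ≤ Hc μ p y := by
  have := D.hm
  have := D.hμ
  have := D.hprob
  have hpy : ∀ i k, MeasurableSet (p ⁻¹' {i} ∩ y ⁻¹' {k}) := fun i k => (hp i).inter (hy k)
  have ct := fun i k => concave_term m (D.meas_real (hpy i k)) (D.meas_real (hy k))
    (fun ω => measureReal_nonneg) (fun ω => measureReal_mono inter_subset_right)
    (fun ω => measureReal_le_one)
  rw [Hc_expand μ hp hy]
  simp_rw [Hc_expand (μω _) hp hy]
  rw [integral_finsetSum _ (fun i _ => integrable_finsetSum _ fun k _ => (ct i k).1)]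
  refine Finset.sum_le_sum fun i _ => ?_
  rw [integral_finsetSum _ (fun k _ => (ct i k).1)]
  refine Finset.sum_le_sum fun k _ => ?_
  rw [D.real_eq (hpy i k), D.real_eq (hy k)]
  exact (ct i k).2

lemma Hn_chain (μ : Measure X) [IsProbabilityMeasure μ] {p : X → ι} {c : X → τ} (hp : MF p)
    (hc : MF c) : Hn μ (fun x => (p x, c x)) = Hn μ c +
      ∑ j, μ.real (c ⁻¹' {j}) * Hn (ProbabilityTheory.cond μ (c ⁻¹' {j})) p := by
  unfold Hn
  rw [Fintype.sum_prod_type, Finset.sum_comm, ← Finset.sum_add_distrib]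
  refine Finset.sum_congr rfl fun j _ => ?_
  have h1 : ∀ i, μ.real ((fun x => (p x, c x)) ⁻¹' {(i, j)}) =
      μ.real (c ⁻¹' {j}) * (ProbabilityTheory.cond μ (c ⁻¹' {j})).real (p ⁻¹' {i}) := by
    intro i
    rw [measureReal_def (μ := ProbabilityTheory.cond μ (c ⁻¹' {j})), ProbabilityTheory.cond_apply (hc j),
      ENNReal.toReal_mul, ENNReal.toReal_inv, ← measureReal_def, ← measureReal_def]
    have : (fun x => (p x, c x)) ⁻¹' {(i, j)} = c ⁻¹' {j} ∩ p ⁻¹' {i} := by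
      ext x; simp [and_comm]
    rw [this]
    by_cases h0 : μ.real (c ⁻¹' {j}) = 0
    · rw [h0]; simp
      exact measureReal_mono_null inter_subset_left h0
    · field_simp
  simp_rw [h1, Real.negMulLog_mul, Finset.sum_add_distrib, ← Finset.mul_sum, ← Finset.sum_mul]
  congr 1
  by_cases h0 : μ.real (c ⁻¹' {j}) = 0
  · rw [h0]; simp
  · have h2 : μ (c ⁻¹' {j}) ≠ 0 := fun h => h0 (by rw [Measure.real, h]; simp)
    have := ProbabilityTheory.cond_isProbabilityMeasure h2
    have h3 := marg (ProbabilityTheory.cond μ (c ⁻¹' {j})) hp univ MeasurableSet.univ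
    simp at h3
    rw [← h3]; simp

lemma Hn_unit (μ : Measure X) [IsProbabilityMeasure μ] : Hn μ (fun _ => ()) = 0 := by
  simp [Hn]

lemma Hc_decomp (μ : Measure X) [IsProbabilityMeasure μ] {p : X → ι} {y : X → κ} {c : X → τ}
    (hp : MF p) (hy : MF y) (hc : MF c) : Hc μ p y ≤ Hn μ c +
      ∑ j, μ.real (c ⁻¹' {j}) * Hc (ProbabilityTheory.cond μ (c ⁻¹' {j})) p y := by
  have h1 := Hn_chain μ (hp.pair hy) hc
  have h2 := Hn_chain μ hy hc
  have h3 := Hn_map_le μ ((hp.pair hy).pair hc) Prod.fst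
  have hu : MF (fun _ : X => ()) := fun _ => by simp
  have h4 := Hn_submod μ hy hc hu
  have h5 := Hn_map_le μ (hy.pair (hc.pair hu)) (fun z => (z.1, z.2.1))
  have h6 := Hn_map_le μ hy (fun z => (z, ()))
  have h7 := Hn_map_le μ hc (fun z => (z, ()))
  rw [Hn_unit] at h4
  unfold Hc
  simp only [mul_sub, Finset.sum_sub_distrib] at *
  linarith

end Conc

end AscPf

namespace AscPf

set_option linter.unusedSectionVars false

section Comb

variable {G : Type*} [Group G] [DecidableEq G]

lemma coeff_int {lam : Measure ℝ} (hlam : IsCoeffMeasure lam) (s n : ℕ) :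
    Integrable (fun x : ℝ => x ^ s * (1 - x) ^ n) lam := by
  have := hlam.1
  refine Integrable.of_bound (C := 1) (by fun_prop) ?_
  have h : ∀ᵐ x ∂lam, x ∈ Icc (0 : ℝ) 1 := by rw [ae_iff]; exact hlam.2.1
  filter_upwards [h] with x hx
  have h1 : 0 ≤ x ^ s := pow_nonneg hx.1 _
  have h2 : 0 ≤ (1 - x) ^ n := pow_nonneg (by linarith [hx.2]) _
  rw [Real.norm_of_nonneg (mul_nonneg h1 h2)]
  exact mul_le_one₀ (pow_le_one₀ hx.1 hx.2) h2 (pow_le_one₀ (by linarith [hx.2]) (by linarith [hx.1]))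

lemma coeff_nonneg {lam : Measure ℝ} (hlam : IsCoeffMeasure lam) (A S : Finset G) :
    0 ≤ coeff lam A S := by
  have h : ∀ᵐ x ∂lam, x ∈ Icc (0 : ℝ) 1 := by rw [ae_iff]; exact hlam.2.1
  apply integral_nonneg_of_ae
  filter_upwards [h] with x hx
  exact mul_nonneg (pow_nonneg hx.1 _) (pow_nonneg (by linarith [hx.2]) _)

lemma coeff_empty {lam : Measure ℝ} (hlam : IsCoeffMeasure lam) :
    coeff lam (∅ : Finset G) ∅ = 1 := by
  have := hlam.1
  simp [coeff]

lemma coeff_insert {lam : Measure ℝ} (hlam : IsCoeffMeasure lam) {A S : Finset G} (hS : S ⊆ A)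
    {e : G} (he : e ∉ A) :
    coeff lam (insert e A) S + coeff lam (insert e A) (insert e S) = coeff lam A S := by
  unfold coeff
  rw [← integral_add (coeff_int hlam _ _) (coeff_int hlam _ _)]
  congr 1
  ext x
  rw [Finset.card_insert_of_notMem he, Finset.card_insert_of_notMem (fun h => he (hS h))]
  have h1 : A.card + 1 - S.card = (A.card - S.card) + 1 := by
    have := Finset.card_le_card hS; omega
  have h2 : A.card + 1 - (S.card + 1) = A.card - S.card := by omega
  rw [h1, h2]; ring

def aF (lam : Measure ℝ) (f : Finset G → ℝ) (A : Finset G) : ℝ :=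
  ∑ S ∈ A.powerset, coeff lam A S * f S

lemma aF_consist {lam : Measure ℝ} (hlam : IsCoeffMeasure lam) (f : Finset G → ℝ)
    {A B : Finset G} (hBA : B ⊆ A) :
    aF lam f B = ∑ S ∈ A.powerset, coeff lam A S * f (S ∩ B) := by
  have key : ∀ C : Finset G, Disjoint B C →
      ∑ S ∈ (B ∪ C).powerset, coeff lam (B ∪ C) S * f (S ∩ B) = aF lam f B := by
    intro C
    induction C using Finset.induction_on with
    | empty =>
      intro _
      rw [Finset.union_empty]
      refine Finset.sum_congr rfl fun S hS => ?_
      rw [Finset.inter_eq_left.2 (Finset.mem_powerset.1 hS)]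
    | insert e C he ih =>
      intro hd
      rw [Finset.disjoint_insert_right] at hd
      rw [← ih hd.2, Finset.union_insert]
      have hn : e ∉ B ∪ C := by simp [hd.1, he]
      rw [Finset.sum_powerset_insert hn, ← Finset.sum_add_distrib]
      refine Finset.sum_congr rfl fun S hS => ?_
      rw [Finset.mem_powerset] at hS
      rw [Finset.insert_inter_of_notMem hd.1, ← add_mul, coeff_insert hlam hS hn]
  have := key (A \ B) Finset.disjoint_sdiff
  rw [Finset.union_sdiff_of_subset hBA] at this
  exact this.symm

lemma coeff_sum {lam : Measure ℝ} (hlam : IsCoeffMeasure lam) (A : Finset G) :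
    ∑ S ∈ A.powerset, coeff lam A S = 1 := by
  have := aF_consist hlam (fun _ => 1) (Finset.empty_subset A)
  simp [aF, coeff_empty hlam] at this
  exact this.symm

structure SubMod (f : Finset G → ℝ) : Prop where
  emp : f ∅ = 0
  mono : ∀ S T, S ⊆ T → f S ≤ f T
  submod : ∀ S T, f (S ∪ T) + f (S ∩ T) ≤ f S + f T
  inv : ∀ (S : Finset G) (g : G), f (S.image (fun s => s * g)) = f S

lemma SubMod.nonneg {f : Finset G → ℝ} (hf : SubMod f) (S : Finset G) : 0 ≤ f S := by
  rw [← hf.emp]; exact hf.mono _ _ (Finset.empty_subset _)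

lemma aF_nonneg {lam : Measure ℝ} (hlam : IsCoeffMeasure lam) {f : Finset G → ℝ} (hf : SubMod f)
    (A : Finset G) : 0 ≤ aF lam f A :=
  Finset.sum_nonneg fun S _ => mul_nonneg (coeff_nonneg hlam _ _) (hf.nonneg S)

lemma shearer {f : Finset G → ℝ} (hf : SubMod f) {J : Type*} (I : Finset J) (A : J → Finset G)
    (k : ℕ) (F : Finset G) (h : ∀ x ∈ F, (I.filter (fun i => x ∈ A i)).card = k) :
    k * f F ≤ ∑ i ∈ I, f (A i ∩ F) := by
  induction F using Finset.induction_on with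
  | empty => simp [hf.emp]
  | insert x F hx ih =>
    have ih := ih (fun y hy => h y (Finset.mem_insert_of_mem hy))
    have hk := h x (Finset.mem_insert_self _ _)
    have key : ∀ i ∈ I, f (A i ∩ F) + (if x ∈ A i then (f (insert x F) - f F) else 0) ≤
        f (A i ∩ insert x F) := by
      intro i _
      split_ifs with hxi
      · have h1 := hf.submod (A i ∩ insert x F) F
        have e1 : (A i ∩ insert x F) ∪ F = insert x F := by
          ext z; simp; grind
        have e2 : (A i ∩ insert x F) ∩ F = A i ∩ F := by
          ext z; simp; grind
        rw [e1, e2] at h1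
        linarith
      · rw [Finset.inter_insert_of_notMem hxi]; simp
    have h2 := Finset.sum_le_sum key
    rw [Finset.sum_add_distrib, ← Finset.sum_filter, Finset.sum_const, hk, nsmul_eq_mul] at h2
    linarith

def KinvF (K F : Finset G) : Finset G := K.biUnion fun k => F.image fun h => k⁻¹ * h

lemma aF_trans {lam : Measure ℝ} {f : Finset G → ℝ} (hf : SubMod f)
    (K : Finset G) (g : G) : aF lam f (K.image (fun s => s * g)) = aF lam f K := by
  unfold aF
  have hinj : Function.Injective (fun s : G => s * g) := mul_left_injective g
  rw [Finset.powerset_image, Finset.sum_image]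
  · refine Finset.sum_congr rfl fun S _ => ?_
    rw [hf.inv]
    unfold coeff
    rw [Finset.card_image_of_injective _ hinj, Finset.card_image_of_injective _ hinj]
  · intro S _ T _ hST
    exact Finset.image_injective hinj hST

lemma aF_shearer {lam : Measure ℝ} (hlam : IsCoeffMeasure lam) {f : Finset G → ℝ} (hf : SubMod f)
    (K F : Finset G) : K.card * aF lam f F ≤ (KinvF K F).card * aF lam f K := by
  set A := F ∪ (KinvF K F).biUnion fun g => K.image (fun s => s * g) with hA
  have h1 : ((KinvF K F).card : ℝ) * aF lam f K =
      ∑ g ∈ KinvF K F, ∑ S ∈ A.powerset, coeff lam A S * f (S ∩ K.image (fun s => s * g)) := by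
    rw [Finset.sum_congr rfl (g := fun _ => aF lam f K)]
    · rw [Finset.sum_const, nsmul_eq_mul]
    · intro g hg
      rw [← aF_consist hlam f, aF_trans hf]
      exact (Finset.subset_biUnion_of_mem (fun g => K.image (fun s => s * g)) hg).trans
        Finset.subset_union_right
  rw [h1, aF_consist hlam f (A := A) Finset.subset_union_left, Finset.sum_comm, Finset.mul_sum]
  refine Finset.sum_le_sum fun S _ => ?_
  rw [← Finset.mul_sum, mul_left_comm]
  refine mul_le_mul_of_nonneg_left ?_ (coeff_nonneg hlam _ _)
  refine (shearer hf (KinvF K F) (fun g => S ∩ K.image (fun s => s * g)) K.card (S ∩ F) ?_).trans ?_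
  · intro x hx
    rw [Finset.mem_inter] at hx
    have : (KinvF K F).filter (fun g => x ∈ S ∩ K.image (fun s => s * g)) =
        K.image (fun k => k⁻¹ * x) := by
      ext g
      simp only [KinvF, Finset.mem_filter, Finset.mem_biUnion, Finset.mem_image, Finset.mem_inter]
      constructor
      · rintro ⟨_, _, k, hk, rfl⟩
        exact ⟨k, hk, by group⟩
      · rintro ⟨k, hk, rfl⟩
        exact ⟨⟨k, hk, x, hx.2, rfl⟩, hx.1, k, hk, by group⟩
    rw [this, Finset.card_image_of_injective]
    intro a b hab
    simpa using hab
  · exact Finset.sum_le_sum fun g _ => hf.mono _ _ Finset.inter_subset_left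

lemma KinvF_tendsto {F : ℕ → Finset G} (hF : IsFolner F) (K : Finset G) :
    ∃ e : ℕ → ℝ, Tendsto e atTop (nhds 0) ∧ ∀ n, ((KinvF K (F n)).card : ℝ) ≤ (1 + e n) * (F n).card := by
  refine ⟨fun n => ∑ k ∈ K, ((((((F n).image fun h => k⁻¹ * h) \ F n) ∪
    (F n \ ((F n).image fun h => k⁻¹ * h)))).card : ℝ) / ((F n).card : ℝ), ?_, ?_⟩
  · have := tendsto_finsetSum K (fun k _ => hF.2 k⁻¹)
    simpa using this
  · intro n
    have hpos : (0 : ℝ) < (F n).card := by exact_mod_cast (hF.1 n).card_pos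
    rw [add_mul, Finset.sum_mul, one_mul]
    simp_rw [div_mul_cancel₀ _ hpos.ne']
    have h1 : KinvF K (F n) ⊆ F n ∪ K.biUnion fun k => ((((F n).image fun h => k⁻¹ * h) \ F n) ∪
      (F n \ ((F n).image fun h => k⁻¹ * h))) := by
      intro x hx
      simp only [KinvF, Finset.mem_biUnion] at hx
      obtain ⟨k, hk, hx⟩ := hx
      by_cases hxF : x ∈ F n
      · exact Finset.mem_union_left _ hxF
      · refine Finset.mem_union_right _ (Finset.mem_biUnion.2 ⟨k, hk, ?_⟩)
        exact Finset.mem_union_left _ (Finset.mem_sdiff.2 ⟨hx, hxF⟩)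
    have h2 := (Finset.card_le_card h1).trans ((Finset.card_union_le _ _).trans
      (Nat.add_le_add_left Finset.card_biUnion_le _))
    exact_mod_cast h2

lemma folner_card [Infinite G] {F : ℕ → Finset G} (hF : IsFolner F) :
    Tendsto (fun n => ((F n).card : ℝ)) atTop atTop := by
  rw [tendsto_atTop]
  intro b
  obtain ⟨N, hN⟩ := exists_nat_gt (2 * |b|)
  obtain ⟨K, hK⟩ := Infinite.exists_subset_card_eq G N
  obtain ⟨e, he, hle⟩ := KinvF_tendsto hF K
  filter_upwards [he.eventually (gt_mem_nhds (zero_lt_one))] with n hn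
  have hpos : (0 : ℝ) < (F n).card := by exact_mod_cast (hF.1 n).card_pos
  have h1 : K.card ≤ (KinvF K (F n)).card := by
    obtain ⟨x, hx⟩ := hF.1 n
    rw [← Finset.card_image_of_injective K (f := fun k => k⁻¹ * x)]
    · refine Finset.card_le_card ?_
      intro z hz
      obtain ⟨k, hk, rfl⟩ := Finset.mem_image.1 hz
      exact Finset.mem_biUnion.2 ⟨k, hk, Finset.mem_image_of_mem _ hx⟩
    · intro a b hab
      simpa using hab
  have h2 : (N : ℝ) ≤ (KinvF K (F n)).card := by rw [← hK]; exact_mod_cast h1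
  have h3 := hle n
  have := le_abs_self b
  nlinarith

lemma aF_tendsto {lam : Measure ℝ} (hlam : IsCoeffMeasure lam) {f : Finset G → ℝ} (hf : SubMod f)
    {F : ℕ → Finset G} (hF : IsFolner F) :
    Tendsto (fun n => aF lam f (F n) / (F n).card) atTop
      (nhds (⨅ K : {K : Finset G // K.Nonempty}, aF lam f K.1 / (K.1.card : ℝ))) := by
  have hbdd : BddBelow (range fun K : {K : Finset G // K.Nonempty} => aF lam f K.1 / (K.1.card : ℝ)) :=
    ⟨0, by rintro _ ⟨K, rfl⟩; exact div_nonneg (aF_nonneg hlam hf _) (by positivity)⟩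
  rw [tendsto_order]
  constructor
  · intro a ha
    exact Eventually.of_forall fun n => ha.trans_le (ciInf_le hbdd ⟨F n, hF.1 n⟩)
  · intro a ha
    have : Nonempty {K : Finset G // K.Nonempty} := ⟨⟨F 0, hF.1 0⟩⟩
    obtain ⟨K, hK⟩ := exists_lt_of_ciInf_lt ha
    obtain ⟨e, he, hle⟩ := KinvF_tendsto hF K.1
    have ht : Tendsto (fun n => (1 + e n) * (aF lam f K.1 / (K.1.card : ℝ))) atTop
        (nhds ((1 + 0) * (aF lam f K.1 / (K.1.card : ℝ)))) :=
      (tendsto_const_nhds.add he).mul_const _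
    rw [add_zero, one_mul] at ht
    filter_upwards [ht.eventually (gt_mem_nhds hK)] with n hn
    refine lt_of_le_of_lt ?_ hn
    have hpos : (0 : ℝ) < (F n).card := by exact_mod_cast (hF.1 n).card_pos
    have hKpos : (0 : ℝ) < K.1.card := by exact_mod_cast K.2.card_pos
    have h1 := aF_shearer hlam hf K.1 (F n)
    have h2 := mul_le_mul_of_nonneg_right (hle n) (aF_nonneg hlam hf K.1)
    rw [mul_div_assoc', div_le_div_iff₀ hpos hKpos]
    linarith

end Comb

end AscPf

namespace AscPf

set_option linter.unusedSectionVars false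

section Levy

variable {X Y ι κ τ : Type*} [MeasurableSpace X] [Fintype ι] [Fintype κ] [Fintype τ]

lemma integral_comp_fin (ν : Measure X) [IsFiniteMeasure ν] {y : X → κ} (hy : MF y) (g : κ → ℝ) :
    ∫ x, g (y x) ∂ν = ∑ k, ν.real (y ⁻¹' {k}) * g k := by
  let _ : MeasurableSpace κ := ⊤
  have hym : Measurable y := fun s _ => hy.preimage s
  rw [← integral_map (f := g) hym.aemeasurable (by
    exact (measurable_from_top).aestronglyMeasurable)]
  rw [integral_fintype .of_finite]
  refine Finset.sum_congr rfl fun k _ => ?_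
  rw [map_measureReal_apply hym (by trivial), smul_eq_mul]

lemma condExp_fin (ν : Measure X) [IsFiniteMeasure ν] {y : X → κ} (hy : MF y) {A : Set X}
    (hA : MeasurableSet A) :
    (fun x => ν.real (A ∩ y ⁻¹' {y x}) / ν.real (y ⁻¹' {y x})) =ᵐ[ν]
      ν[A.indicator (fun _ => (1 : ℝ)) | MeasurableSpace.comap y ⊤] := by
  have hle : MeasurableSpace.comap y ⊤ ≤ ‹MeasurableSpace X› := by
    rintro _ ⟨s, _, rfl⟩; exact hy.preimage s
  have hsm : StronglyMeasurable[MeasurableSpace.comap y ⊤]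
      (fun x => ν.real (A ∩ y ⁻¹' {y x}) / ν.real (y ⁻¹' {y x})) := by
    apply Measurable.stronglyMeasurable
    let _ : MeasurableSpace κ := ⊤
    exact @Measurable.comp _ _ _ (MeasurableSpace.comap y ⊤) ⊤ _
      (fun k => ν.real (A ∩ y ⁻¹' {k}) / ν.real (y ⁻¹' {k})) y
      measurable_from_top (comap_measurable y)
  have hint : Integrable (fun x => ν.real (A ∩ y ⁻¹' {y x}) / ν.real (y ⁻¹' {y x})) ν := by
    refine Integrable.of_bound (C := 1) (hsm.mono hle).aestronglyMeasurable
      (Eventually.of_forall fun x => ?_)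
    rw [Real.norm_of_nonneg (by positivity)]
    exact div_le_one_of_le₀ (measureReal_mono inter_subset_right) measureReal_nonneg
  refine ae_eq_condExp_of_forall_setIntegral_eq hle ?_ ?_ ?_ ?_
  · exact (integrable_const 1).indicator hA
  · intro s _ _; exact hint.integrableOn
  · rintro _ ⟨t, _, rfl⟩ _
    classical
    rw [setIntegral_indicator hA]
    simp only [integral_const, MeasurableSet.univ, measureReal_restrict_apply, univ_inter, smul_eq_mul, mul_one]
    rw [← integral_indicator (hy.preimage t)]
    have e1 : ∀ x, (y ⁻¹' t).indicator
        (fun x => ν.real (A ∩ y ⁻¹' {y x}) / ν.real (y ⁻¹' {y x})) x =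
        t.indicator (fun k => ν.real (A ∩ y ⁻¹' {k}) / ν.real (y ⁻¹' {k})) (y x) := by
      intro x
      by_cases h : y x ∈ t <;> simp [indicator, h]
    simp_rw [e1]
    rw [integral_comp_fin ν hy, marg ν hy _ ((hy.preimage t).inter hA)]
    refine Finset.sum_congr rfl fun k _ => ?_
    by_cases h : k ∈ t
    · rw [indicator_of_mem h]
      have e2 : y ⁻¹' {k} ∩ (y ⁻¹' t ∩ A) = A ∩ y ⁻¹' {k} := by
        ext x; simp; constructor
        · tauto
        · rintro ⟨h1, h2⟩; rw [h2]; exact ⟨rfl, h, h1⟩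
      rw [e2]
      by_cases h0 : ν.real (y ⁻¹' {k}) = 0
      · rw [h0]; simp; exact (measureReal_mono_null inter_subset_right h0).symm
      · field_simp
    · rw [indicator_of_notMem h]
      have e2 : y ⁻¹' {k} ∩ (y ⁻¹' t ∩ A) = ∅ := by
        ext x; simp; rintro h1 h2; rw [h1] at h2; exact absurd h2 h
      rw [e2]; simp
  · exact hsm.aestronglyMeasurable

lemma Hc_integral (ν : Measure X) [IsFiniteMeasure ν] {p : X → ι} {y : X → κ} (hp : MF p)
    (hy : MF y) : Hc ν p y = ∑ i, ∫ x, Real.negMulLog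
      (ν.real (p ⁻¹' {i} ∩ y ⁻¹' {y x}) / ν.real (y ⁻¹' {y x})) ∂ν := by
  rw [Hc_expand ν hp hy]
  refine Finset.sum_congr rfl fun i _ => ?_
  rw [integral_comp_fin ν hy
    (fun k => Real.negMulLog (ν.real (p ⁻¹' {i} ∩ y ⁻¹' {k}) / ν.real (y ⁻¹' {k})))]
  refine Finset.sum_congr rfl fun k _ => ?_
  by_cases h0 : ν.real (y ⁻¹' {k}) = 0
  · have h1 : ν.real (p ⁻¹' {i} ∩ y ⁻¹' {k}) = 0 := measureReal_mono_null inter_subset_right h0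
    rw [h0, h1]; simp
  · by_cases h1 : ν.real (p ⁻¹' {i} ∩ y ⁻¹' {k}) = 0
    · rw [h1]; simp
    · rw [Real.negMulLog, Real.negMulLog, Real.log_div h1 h0]
      field_simp
      ring

open Classical in
def yk (π : X → Y) (V : ℕ → Set Y) (k : ℕ) (x : X) : Fin k → Bool :=
  fun i => decide (π x ∈ V i)

def CE [MeasurableSpace Y] (ν : Measure X) (π : X → Y) (p : X → ι) : ℝ :=
  ∑ i, ∫ x, Real.negMulLog
    ((ν[(p ⁻¹' {i}).indicator (fun _ => (1 : ℝ)) | MeasurableSpace.comap π ‹_›]) x) ∂ν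

lemma yk_MF [MeasurableSpace Y] {π : X → Y} (hπ : Measurable π) {V : ℕ → Set Y}
    (hV : ∀ i, MeasurableSet (V i)) (k : ℕ) : MF (yk π V k) := by
  intro v
  have : yk π V k ⁻¹' {v} = ⋂ i : Fin k, (if v i then π ⁻¹' (V i) else (π ⁻¹' (V i))ᶜ) := by
    ext x
    simp only [yk, mem_preimage, mem_singleton_iff, mem_iInter, funext_iff]
    refine forall_congr' fun i => ?_
    cases h : v i <;> simp
  rw [this]
  refine MeasurableSet.iInter fun i => ?_
  split_ifs
  · exact hπ (hV i)
  · exact (hπ (hV i)).compl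

lemma yk_le (π : X → Y) (V : ℕ → Set Y) {k l : ℕ} (h : k ≤ l) :
    yk π V k = fun x => (fun v : Fin l → Bool => fun i : Fin k => v (Fin.castLE h i)) (yk π V l x) := by
  ext x i; simp [yk]

lemma yk_meas [MeasurableSpace Y] {π : X → Y} {V : ℕ → Set Y}
    (hgen : MeasurableSpace.generateFrom (range V) = ‹MeasurableSpace Y›) :
    ⨆ k, MeasurableSpace.comap (yk π V k) ⊤ = MeasurableSpace.comap π ‹_› := by
  have hV : ∀ i, MeasurableSet (V i) := fun i => by
    rw [← hgen]; exact MeasurableSpace.measurableSet_generateFrom ⟨i, rfl⟩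
  apply le_antisymm
  · refine iSup_le fun k => ?_
    rintro _ ⟨s, _, rfl⟩
    let _ : MeasurableSpace X := MeasurableSpace.comap π ‹_›
    exact (yk_MF (comap_measurable π) hV k).preimage s
  · rw [← hgen, MeasurableSpace.comap_generateFrom]
    apply MeasurableSpace.generateFrom_le
    rintro _ ⟨_, ⟨i, rfl⟩, rfl⟩
    refine (le_iSup (fun k => MeasurableSpace.comap (yk π V k) ⊤) (i+1)) _ ?_
    refine ⟨{v | v (Fin.last i) = true}, trivial, ?_⟩
    ext x; simp [yk]

lemma levy [MeasurableSpace Y] (ν : Measure X) [IsFiniteMeasure ν] {π : X → Y} (hπ : Measurable π)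
    {V : ℕ → Set Y}
    (hgen : MeasurableSpace.generateFrom (range V) = ‹MeasurableSpace Y›)
    {p : X → ι} (hp : MF p) :
    Tendsto (fun k => Hc ν p (yk π V k)) atTop (nhds (CE ν π p)) := by
  have hV : ∀ i, MeasurableSet (V i) := fun i => by
    rw [← hgen]; exact MeasurableSpace.measurableSet_generateFrom ⟨i, rfl⟩
  have hy := fun k => yk_MF hπ hV k
  let ℱ : Filtration ℕ ‹MeasurableSpace X› :=
    { seq := fun k => MeasurableSpace.comap (yk π V k) ⊤
      mono' := by
        intro k l h
        rintro _ ⟨s, _, rfl⟩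
        rw [yk_le π V h]
        exact ⟨(fun v : Fin l → Bool => fun i : Fin k => v (Fin.castLE h i)) ⁻¹' s, trivial, rfl⟩
      le' := by
        intro k
        rintro _ ⟨s, _, rfl⟩; exact (hy k).preimage s }
  simp_rw [fun k => Hc_integral ν hp (hy k)]
  unfold CE
  refine tendsto_finsetSum _ fun i _ => ?_
  have hl := tendsto_ae_condExp (μ := ν) (ℱ := ℱ) ((p ⁻¹' {i}).indicator (fun _ => (1 : ℝ)))
  have hsup : ⨆ k, ℱ k = MeasurableSpace.comap π ‹_› := yk_meas hgen
  rw [hsup] at hl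
  have hall := ae_all_iff.2 (fun k => condExp_fin ν (hy k) (hp i))
  refine tendsto_integral_of_dominated_convergence (fun _ => 1) ?_ (integrable_const 1) ?_ ?_
  · intro k
    let _ : MeasurableSpace (Fin k → Bool) := ⊤
    have hym : Measurable (yk π V k) := fun s _ => (hy k).preimage s
    exact (Measurable.comp (g := fun v => Real.negMulLog
      (ν.real (p ⁻¹' {i} ∩ yk π V k ⁻¹' {v}) / ν.real (yk π V k ⁻¹' {v})))
      measurable_from_top hym).aestronglyMeasurable
  · intro k
    refine Eventually.of_forall fun x => ?_
    have h0 : 0 ≤ ν.real (p ⁻¹' {i} ∩ yk π V k ⁻¹' {yk π V k x}) / ν.real (yk π V k ⁻¹' {yk π V k x}) := by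
      positivity
    rw [Real.norm_of_nonneg (Real.negMulLog_nonneg h0
      (div_le_one_of_le₀ (measureReal_mono inter_subset_right) measureReal_nonneg))]
    exact nml_le_one h0
  · filter_upwards [hl, hall] with x hx hx2
    refine (Real.continuous_negMulLog.tendsto _).comp ?_
    refine hx.congr fun k => ?_
    exact (hx2 k).symm

end Levy

end AscPf

namespace AscPf

set_option linter.unusedSectionVars false

section PartS

variable {G X Y ι κ τ : Type*} [MeasurableSpace X] [MeasurableSpace Y]
  [Fintype ι] [Fintype κ] [Fintype τ] [Group G] [DecidableEq G]

open Classical in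
def part (p : X → ι) : Finset (Set X) := Finset.univ.image (fun i => p ⁻¹' {i})

def qS (act : G → X → X) (q : X → ι) (S : Finset G) (x : X) : S → ι := fun s => q (act s x)

lemma coverDyn_part (act : G → X → X) (q : X → ι) (S : Finset G) :
    coverDyn act (part q) S = part (qS act q S) := by
  classical
  ext A
  unfold coverDyn part
  simp only [Finset.mem_image, Finset.mem_pi, Finset.mem_univ, true_and]
  constructor
  · rintro ⟨f, hf, rfl⟩
    choose i hi using hf
    refine ⟨fun s => i s.1 s.2, ?_⟩
    ext x
    simp only [mem_preimage, mem_singleton_iff, mem_iInter, funext_iff, qS, Subtype.forall]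
    refine forall_congr' fun g => forall_congr' fun h => ?_
    rw [← hi g h]; rfl
  · rintro ⟨s, rfl⟩
    refine ⟨fun g h => q ⁻¹' {s ⟨g, h⟩}, fun g h => ⟨_, rfl⟩, ?_⟩
    ext x
    simp only [mem_preimage, mem_singleton_iff, mem_iInter, funext_iff, qS, Subtype.forall]

lemma condEntPart_part (ν : Measure X) (π : X → Y) (p : X → ι) :
    condEntPart ν π (part p) = CE ν π p := by
  classical
  unfold condEntPart part CE
  rw [Finset.sum_image_of_pairwise_eq_zero]
  intro i _ j _ hij h
  have h : p ⁻¹' {i} = p ⁻¹' {j} := h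
  have : p ⁻¹' {i} = ∅ := by
    ext x
    simp only [mem_empty_iff_false, iff_false]
    intro hx
    have hx2 : x ∈ p ⁻¹' {j} := h ▸ hx
    exact hij (hx.symm.trans hx2)
  rw [this]
  have h0 : (∅ : Set X).indicator (fun _ => (1 : ℝ)) = 0 := by ext x; simp
  rw [h0, condExp_zero]
  simp

structure Sys (act : G → X → X) (actY : G → Y → Y) (π : X → Y) (V : ℕ → Set Y) : Prop where
  hact : ∀ g, Measurable (act g)
  hact1 : ∀ x, act 1 x = x
  hactm : ∀ g h x, act (g * h) x = act g (act h x)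
  hactY : ∀ g, Measurable (actY g)
  hactY1 : ∀ x, actY 1 x = x
  hactYm : ∀ g h x, actY (g * h) x = actY g (actY h x)
  hπ : Measurable π
  hfac : ∀ g x, π (act g x) = actY g (π x)
  hgen : MeasurableSpace.generateFrom (range V) = ‹MeasurableSpace Y›

variable {act : G → X → X} {actY : G → Y → Y} {π : X → Y} {V : ℕ → Set Y}

lemma Sys.hV (hs : Sys act actY π V) (i : ℕ) : MeasurableSet (V i) := by
  rw [← hs.hgen]; exact MeasurableSpace.measurableSet_generateFrom ⟨i, rfl⟩

lemma Sys.hy (hs : Sys act actY π V) (k : ℕ) : MF (yk π V k) := yk_MF hs.hπ hs.hV k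

lemma Sys.qS_MF (hs : Sys act actY π V) {q : X → ι} (hq : MF q) (S : Finset G) :
    MF (qS act q S) := by
  intro v
  have : qS act q S ⁻¹' {v} = ⋂ s : S, act s ⁻¹' (q ⁻¹' {v s}) := by
    ext x; simp [qS, funext_iff]
  rw [this]
  exact MeasurableSet.iInter fun s => hs.hact _ (hq _)

lemma Sys.CE_map_le (hs : Sys act actY π V) (ν : Measure X) [IsFiniteMeasure ν] {p : X → ι}
    (hp : MF p) (r : ι → κ) : CE ν π (fun x => r (p x)) ≤ CE ν π p :=
  le_of_tendsto_of_tendsto' (levy ν hs.hπ hs.hgen (hp.map r)) (levy ν hs.hπ hs.hgen hp)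
    fun k => Hc_map_le ν hp (hs.hy k) r

lemma Hn_inv {T : X → X} (hT : Measurable T) {ν : Measure X} (hν : Measure.map T ν = ν) {p : X → ι}
    (hp : MF p) : Hn ν (fun x => p (T x)) = Hn ν p := by
  unfold Hn
  refine Finset.sum_congr rfl fun i _ => ?_
  congr 1
  conv_rhs => rw [← hν]
  rw [map_measureReal_apply hT (hp i)]
  rfl

lemma Hc_inv {T : X → X} (hT : Measurable T) {ν : Measure X} (hν : Measure.map T ν = ν) {p : X → ι}
    (hp : MF p) {y : X → κ} (hy : MF y) : Hc ν (fun x => p (T x)) (fun x => y (T x)) = Hc ν p y := by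
  unfold Hc
  rw [Hn_inv hT hν hy, ← Hn_inv hT hν (hp.pair hy)]

lemma Sys.CE_inv (hs : Sys act actY π V) (ν : Measure X) [IsFiniteMeasure ν] (g : G)
    (hν : Measure.map (act g) ν = ν) {p : X → ι}
    (hp : MF p) : CE ν π (fun x => p (act g x)) = CE ν π p := by
  set V' : ℕ → Set Y := fun i => actY g ⁻¹' (V i) with hV'
  have hgen' : MeasurableSpace.generateFrom (range V') = ‹MeasurableSpace Y› := by
    have h1 : range V' = preimage (actY g) '' range V := by
      rw [← range_comp]; rfl
    rw [h1, ← MeasurableSpace.comap_generateFrom, hs.hgen]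
    apply le_antisymm (hs.hactY g).comap_le
    intro s hsm
    refine ⟨actY g⁻¹ ⁻¹' s, hs.hactY _ hsm, ?_⟩
    ext y
    simp [← hs.hactYm, hs.hactY1]
  have hpg : MF (fun x => p (act g x)) := fun i => hs.hact g (hp i)
  have h1 := levy ν hs.hπ hgen' hpg
  have h2 := levy ν hs.hπ hs.hgen hp
  refine tendsto_nhds_unique h1 (h2.congr fun k => ?_)
  rw [← Hc_inv (hs.hact g) hν hp (hs.hy k)]
  congr 1
  ext x i
  simp [yk, hV', hs.hfac]

lemma Sys.CE_le (hs : Sys act actY π V) (ν : Measure X) [IsFiniteMeasure ν] {p : X → ι}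
    (hp : MF p) (k : ℕ) : CE ν π p ≤ Hc ν p (yk π V k) := by
  refine le_of_tendsto (levy ν hs.hπ hs.hgen hp) ?_
  filter_upwards [eventually_ge_atTop k] with l hl
  have := Hc_anti ν hp (hs.hy l) (fun v : Fin l → Bool => fun i : Fin k => v (Fin.castLE hl i))
  rwa [← yk_le π V hl] at this

lemma Sys.submod (hs : Sys act actY π V) (ν : Measure X) [IsFiniteMeasure ν]
    (hν : ∀ g, Measure.map (act g) ν = ν) {q : X → ι}
    (hq : MF q) : SubMod (fun S : Finset G => CE ν π (qS act q S)) where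
  emp := by
    refine tendsto_nhds_unique (levy ν hs.hπ hs.hgen (hs.qS_MF hq ∅)) ?_
    have : ∀ k, Hc ν (qS act q ∅) (yk π V k) = 0 := by
      intro k
      apply le_antisymm _ (Hc_nonneg ν (hs.qS_MF hq ∅) (hs.hy k))
      have h1 := Hn_map_le ν (hs.hy k) (fun v => ((fun s => absurd s.2 (Finset.notMem_empty _) : (∅ : Finset G) → ι), v))
      have h2 : (fun x => (qS act q ∅ x, yk π V k x)) = fun x =>
          ((fun s => absurd s.2 (Finset.notMem_empty _) : (∅ : Finset G) → ι), yk π V k x) := by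
        ext1 x
        congr 1
        exact Subsingleton.elim _ _
      unfold Hc
      rw [h2]
      linarith
    simp_rw [this]
    exact tendsto_const_nhds
  mono := by
    intro S T h
    exact hs.CE_map_le ν (hs.qS_MF hq T) (fun v => fun s : S => v ⟨s.1, h s.2⟩)
  submod := by
    intro S T
    have hS := hs.qS_MF hq S
    have hT := hs.qS_MF hq T
    have hI := hs.qS_MF hq (S ∩ T)
    have hU := hs.qS_MF hq (S ∪ T)
    refine le_of_tendsto_of_tendsto'
      ((levy ν hs.hπ hs.hgen hU).add (levy ν hs.hπ hs.hgen hI))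
      ((levy ν hs.hπ hs.hgen hS).add (levy ν hs.hπ hs.hgen hT)) fun k => ?_
    have hk := hs.hy k
    have h1 := Hc_submod ν hS hT hk hI
    have h2 := Hc_map_le ν (hS.pair (hT.pair hI)) hk
      (fun w => (fun u => if h : u.1 ∈ S then w.1 ⟨u.1, h⟩ else
        w.2.1 ⟨u.1, (Finset.mem_union.1 u.2).resolve_left h⟩ : (S ∪ T : Finset G) → ι))
    have h3 := Hc_map_le ν hS hk (fun v => (v, fun s : (S ∩ T : Finset G) => v ⟨s.1, (Finset.mem_inter.1 s.2).1⟩))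
    have h4 := Hc_map_le ν hT hk (fun v => (v, fun s : (S ∩ T : Finset G) => v ⟨s.1, (Finset.mem_inter.1 s.2).2⟩))
    have e2 : (fun x => (fun u => if h : u.1 ∈ S then qS act q S x ⟨u.1, h⟩ else
        qS act q T x ⟨u.1, (Finset.mem_union.1 u.2).resolve_left h⟩ : (S ∪ T : Finset G) → ι))
        = qS act q (S ∪ T) := by
      ext x u
      simp [qS]
    simp only at h2 h3 h4
    rw [e2] at h2
    change Hc ν (fun x => (qS act q S x, qS act q (S ∩ T) x)) _ ≤ _ at h3
    change Hc ν (fun x => (qS act q T x, qS act q (S ∩ T) x)) _ ≤ _ at h4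
    linarith
  inv := by
    intro S g
    have hS := hs.qS_MF hq S
    have hSg := hs.qS_MF hq (S.image (fun s => s * g))
    have hSg' : MF (fun x => qS act q S (act g x)) := fun i => hs.hact g (hS i)
    rw [← hs.CE_inv ν g (hν g) hS]
    apply le_antisymm
    · have := hs.CE_map_le ν hSg' (fun v => fun u : (S.image (fun s => s * g) : Finset G) =>
        v ⟨u.1 * g⁻¹, by
          obtain ⟨s, hs, h⟩ := Finset.mem_image.1 u.2
          rw [← h]; simpa using hs⟩)
      refine le_trans (le_of_eq ?_) this
      congr 1
      ext x u
      simp only [qS]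
      rw [← hs.hactm]; simp
    · have := hs.CE_map_le ν hSg (fun v => fun u : S =>
        v ⟨u.1 * g, Finset.mem_image_of_mem _ u.2⟩)
      refine le_trans (le_of_eq ?_) this
      congr 1
      ext x u
      simp only [qS]
      rw [← hs.hactm]

abbrev KT (G : Type*) := {K : Finset G // K.Nonempty} × ℕ

def bb (lam : Measure ℝ) (act : G → X → X) (π : X → Y) (V : ℕ → Set Y) (ν : Measure X)
    (q : X → ι) (t : KT G) : ℝ :=
  aF lam (fun S => Hc ν (qS act q S) (yk π V t.2)) t.1.1 / (t.1.1.card : ℝ)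

lemma aF_mono {lam : Measure ℝ} (hlam : IsCoeffMeasure lam) {f f' : Finset G → ℝ}
    (h : ∀ S, f S ≤ f' S) (A : Finset G) : aF lam f A ≤ aF lam f' A :=
  Finset.sum_le_sum fun S _ => mul_le_mul_of_nonneg_left (h S) (coeff_nonneg hlam _ _)

lemma Sys.bb_nonneg (hs : Sys act actY π V) {lam : Measure ℝ} (hlam : IsCoeffMeasure lam)
    (ν : Measure X) [IsFiniteMeasure ν] {q : X → ι} (hq : MF q) (t : KT G) :
    0 ≤ bb lam act π V ν q t :=
  div_nonneg (Finset.sum_nonneg fun S _ => mul_nonneg (coeff_nonneg hlam _ _)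
    (Hc_nonneg ν (hs.qS_MF hq S) (hs.hy _))) (by positivity)

lemma ascSeq_eq (lam : Measure ℝ) (ν : Measure X) (q : X → ι) (F : ℕ → Finset G) :
    ascCondPartSeq ν π (coeff lam) act (part q) F =
      fun n => aF lam (fun S => CE ν π (qS act q S)) (F n) / (F n).card := by
  ext n
  unfold ascCondPartSeq aF
  simp_rw [coverDyn_part, condEntPart_part]
  ring

lemma Sys.asc_part (hs : Sys act actY π V) {lam : Measure ℝ} (hlam : IsCoeffMeasure lam)
    (ν : Measure X) [IsFiniteMeasure ν] (hν : ∀ g, Measure.map (act g) ν = ν) {q : X → ι}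
    (hq : MF q) {F : ℕ → Finset G} (hF : IsFolner F) :
    Tendsto (fun n => aF lam (fun S => CE ν π (qS act q S)) (F n) / (F n).card) atTop
      (nhds (⨅ t : KT G, bb lam act π V ν q t)) ∧
    AscCondPart ν π (coeff lam) act (part q) F = ⨅ t : KT G, bb lam act π V ν q t := by
  have h1 := aF_tendsto hlam (hs.submod ν hν hq) hF
  have hne : Nonempty {K : Finset G // K.Nonempty} := ⟨⟨F 0, hF.1 0⟩⟩
  have hb : BddBelow (range fun t : KT G => bb lam act π V ν q t) :=
    ⟨0, by rintro _ ⟨t, rfl⟩; exact hs.bb_nonneg hlam ν hq t⟩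
  have hb2 : BddBelow (range fun K : {K : Finset G // K.Nonempty} =>
      aF lam (fun S => CE ν π (qS act q S)) K.1 / (K.1.card : ℝ)) :=
    ⟨0, by rintro _ ⟨K, rfl⟩; exact div_nonneg (aF_nonneg hlam (hs.submod ν hν hq) _) (by positivity)⟩
  have h2 : (⨅ K : {K : Finset G // K.Nonempty},
      aF lam (fun S => CE ν π (qS act q S)) K.1 / (K.1.card : ℝ)) =
      ⨅ t : KT G, bb lam act π V ν q t := by
    apply le_antisymm
    · refine le_ciInf fun t => (ciInf_le hb2 t.1).trans ?_
      exact div_le_div_of_nonneg_right (aF_mono hlam (fun S => hs.CE_le ν (hs.qS_MF hq S) t.2) _)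
        (by positivity)
    · refine le_ciInf fun K => ?_
      have ht : Tendsto (fun k => bb lam act π V ν q (K, k)) atTop
          (nhds (aF lam (fun S => CE ν π (qS act q S)) K.1 / (K.1.card : ℝ))) := by
        refine Tendsto.div_const ?_ _
        exact tendsto_finsetSum _ fun S _ =>
          (levy ν hs.hπ hs.hgen (hs.qS_MF hq S)).const_mul _
      exact ge_of_tendsto' ht fun k => ciInf_le hb (K, k)
  rw [h2] at h1
  refine ⟨h1, ?_⟩
  unfold AscCondPart limSeq
  rw [ascSeq_eq]
  exact h1.limUnder_eq

end PartS

end AscPf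

namespace AscPf

set_option linter.unusedSectionVars false

section Adm

variable {G X Y ι κ : Type*} [MeasurableSpace X] [MeasurableSpace Y]
  [Fintype ι] [Fintype κ] [Group G] [DecidableEq G]

/-- admissible selector -/
def Adm (W : ι → Set X) (q : X → ι) : Prop := MF q ∧ ∀ x, x ∈ W (q x)

open Classical in
def pk [Nonempty ι] (s : Finset ι × Finset ι) : ι :=
  if h : s.1.Nonempty then h.choose else if h : s.2.Nonempty then h.choose else Classical.arbitrary ι

open Classical in
def MM (W : ι → Set X) (x : X) : Finset ι := Finset.univ.filter fun i => x ∈ W i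

lemma MM_MF {W : ι → Set X} (hW : ∀ i, MeasurableSet (W i)) : MF (MM W) := by
  classical
  intro s
  have : MM W ⁻¹' {s} = ⋂ i, (if i ∈ s then W i else (W i)ᶜ) := by
    ext x
    simp only [MM, mem_preimage, mem_singleton_iff, Finset.ext_iff, Finset.mem_filter,
      Finset.mem_univ, true_and, mem_iInter]
    refine forall_congr' fun i => ?_
    split_ifs with h <;> simp [h]
  rw [this]
  refine MeasurableSet.iInter fun i => ?_
  split_ifs
  exacts [hW i, (hW i).compl]

def qd [Nonempty ι] (W A : ι → Set X) (x : X) : ι := pk (MM (fun i => A i ∩ W i) x, MM W x)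

lemma qd_adm [Nonempty ι] {W A : ι → Set X} (hW : ∀ i, MeasurableSet (W i))
    (hA : ∀ i, MeasurableSet (A i)) (hc : ∀ x, ∃ i, x ∈ W i) : Adm W (qd W A) := by
  constructor
  · exact ((MM_MF fun i => (hA i).inter (hW i)).pair (MM_MF hW)).map pk
  · intro x
    unfold qd pk
    split_ifs with h1 h2
    · have := h1.choose_spec
      simp only [MM, Finset.mem_filter] at this
      exact this.2.2
    · have := h2.choose_spec
      simp only [MM, Finset.mem_filter] at this
      exact this.2
    · exfalso
      apply h2
      obtain ⟨i, hi⟩ := hc x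
      exact ⟨i, by simp [MM, hi]⟩

lemma qd_eq [Nonempty ι] {W A : ι → Set X} {q : X → ι} (hq : Adm W q) {x : X}
    (hx : ∀ i, x ∈ A i ↔ q x = i) : qd W A x = q x := by
  have h : MM (fun i => A i ∩ W i) x = {q x} := by
    ext i
    simp only [MM, Finset.mem_filter, Finset.mem_univ, true_and, mem_inter_iff, hx,
      Finset.mem_singleton]
    constructor
    · exact fun h => h.1.symm
    · rintro rfl
      exact ⟨rfl, hq.2 x⟩
  unfold qd pk
  rw [h]
  have hn : ({q x} : Finset ι).Nonempty := ⟨_, Finset.mem_singleton_self _⟩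
  rw [dif_pos hn]
  exact Finset.mem_singleton.1 hn.choose_spec

lemma exists_dense [Nonempty ι] [MeasurableSpace.CountablyGenerated X] {W : ι → Set X}
    (hW : ∀ i, MeasurableSet (W i)) (hc : ∀ x, ∃ i, x ∈ W i) :
    ∃ D : ℕ → X → ι, (∀ d, Adm W (D d)) ∧ ∀ (ν : Measure X) [IsFiniteMeasure ν] (q : X → ι),
      Adm W q → ∀ ε > 0, ∃ d, ν.real {x | D d x ≠ q x} < ε := by
  obtain ⟨b, hbc, hb⟩ := MeasurableSpace.CountablyGenerated.isCountablyGenerated (α := X)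
  set 𝔸 := generateSetAlgebra b with h𝔸
  have hAc : 𝔸.Countable := countable_generateSetAlgebra hbc
  have hAa : IsSetAlgebra 𝔸 := isSetAlgebra_generateSetAlgebra
  have hgen : ‹MeasurableSpace X› = MeasurableSpace.generateFrom 𝔸 := by
    rw [h𝔸, generateFrom_generateSetAlgebra_eq]; exact hb
  have hm : ∀ s ∈ 𝔸, MeasurableSet s := fun s hs => by
    rw [hgen]; exact MeasurableSpace.measurableSet_generateFrom hs
  have : Countable 𝔸 := hAc.to_subtype
  have : Nonempty 𝔸 := ⟨⟨∅, hAa.empty_mem⟩⟩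
  obtain ⟨e, he⟩ := exists_surjective_nat (ι → 𝔸)
  refine ⟨fun d => qd W (fun i => (e d i : Set X)), fun d => qd_adm hW (fun i => hm _ (e d i).2) hc, ?_⟩
  intro ν _ q hq ε hε
  have hd := Measure.MeasureDense.of_generateFrom_isSetAlgebra_finite ν hAa hgen
  have hN : (0 : ℝ) < Fintype.card ι := by exact_mod_cast Fintype.card_pos
  choose A hA hA2 using fun i => hd.approx (q ⁻¹' {i}) (hq.1 i) (measure_ne_top _ _)
    (ε / Fintype.card ι) (by positivity)
  obtain ⟨d, hd⟩ := he (fun i => ⟨A i, hA i⟩)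
  refine ⟨d, ?_⟩
  have hA2' : ∀ i, ν.real (symmDiff (q ⁻¹' {i}) (A i)) < ε / Fintype.card ι := by
    intro i
    have := hA2 i
    rw [measureReal_def]
    exact ENNReal.toReal_lt_of_lt_ofReal this
  calc ν.real _ ≤ ν.real (⋃ i, symmDiff (q ⁻¹' {i}) (A i)) := by
        refine measureReal_mono ?_ (measure_ne_top _ _)
        intro x hx
        by_contra hcon
        apply hx
        refine qd_eq hq fun i => ?_
        rw [hd]
        simp only [mem_iUnion, not_exists, mem_symmDiff, mem_preimage, mem_singleton_iff] at hcon
        have := hcon i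
        simp only
        tauto
    _ ≤ ∑ i, ν.real (symmDiff (q ⁻¹' {i}) (A i)) := measureReal_iUnion_fintype_le _
    _ < ∑ i : ι, ε / Fintype.card ι := Finset.sum_lt_sum_of_nonempty Finset.univ_nonempty fun i _ => hA2' i
    _ = ε := by
      rw [Finset.sum_const, Finset.card_univ, nsmul_eq_mul]; field_simp

lemma Hn_tendsto {β : Type*} {l : Filter β} {ν' : β → Measure X} {ν : Measure X} {p' : β → X → ι} {p : X → ι}
    (h : ∀ i, Tendsto (fun n => (ν' n).real (p' n ⁻¹' {i})) l (nhds (ν.real (p ⁻¹' {i})))) :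
    Tendsto (fun n => Hn (ν' n) (p' n)) l (nhds (Hn ν p)) :=
  tendsto_finsetSum _ fun i _ => (Real.continuous_negMulLog.tendsto _).comp (h i)

lemma bb_tendsto {β : Type*} {l : Filter β} {ν' : β → Measure X} {ν : Measure X} {p' : β → X → ι} {p : X → ι}
    {act : G → X → X} {π : X → Y} {V : ℕ → Set Y} {lam : Measure ℝ}
    (h : ∀ S k v, Tendsto (fun n => (ν' n).real ((fun x => (qS act (p' n) S x, yk π V k x)) ⁻¹' {v})) l
      (nhds (ν.real ((fun x => (qS act p S x, yk π V k x)) ⁻¹' {v}))))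
    (h2 : ∀ k v, Tendsto (fun n => (ν' n).real (yk π V k ⁻¹' {v})) l
      (nhds (ν.real (yk π V k ⁻¹' {v})))) (t : KT G) :
    Tendsto (fun n => bb lam act π V (ν' n) (p' n) t) l (nhds (bb lam act π V ν p t)) := by
  refine Tendsto.div_const ?_ _
  refine tendsto_finsetSum _ fun S _ => Tendsto.const_mul _ ?_
  exact (Hn_tendsto (h S t.2)).sub (Hn_tendsto (h2 t.2))

lemma MF.ne_meas {p q : X → ι} (hp : MF p) (hq : MF q) : MeasurableSet {x | p x ≠ q x} := by
  have : {x | p x ≠ q x} = ⋃ i, (p ⁻¹' {i} ∩ (q ⁻¹' {i})ᶜ) := by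
    ext x
    simp [eq_comm]
  rw [this]
  exact MeasurableSet.iUnion fun i => (hp i).inter (hq i).compl

variable {act : G → X → X} {actY : G → Y → Y} {π : X → Y} {V : ℕ → Set Y}

lemma Sys.bb_tendsto_q (hs : Sys act actY π V) {lam : Measure ℝ} (ν : Measure X) [IsFiniteMeasure ν]
    (hν : ∀ g, Measure.map (act g) ν = ν) {p : ℕ → X → ι} {q : X → ι} (hp : ∀ n, MF (p n)) (hq : MF q)
    (h : Tendsto (fun n => ν.real {x | p n x ≠ q x}) atTop (nhds 0)) (t : KT G) :
    Tendsto (fun n => bb lam act π V ν (p n) t) atTop (nhds (bb lam act π V ν q t)) := by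
  refine bb_tendsto (fun S k v => ?_) (fun _ _ => tendsto_const_nhds) t
  rw [tendsto_iff_dist_tendsto_zero]
  have hb : Tendsto (fun n => (S.card : ℝ) * ν.real {x | p n x ≠ q x}) atTop (nhds 0) := by
    simpa using h.const_mul (S.card : ℝ)
  refine squeeze_zero (fun _ => dist_nonneg) (fun n => ?_) hb
  rw [Real.dist_eq]
  have e1 : MeasurableSet ((fun x => (qS act (p n) S x, yk π V k x)) ⁻¹' {v}) :=
    ((hs.qS_MF (hp n) S).pair (hs.hy k)) v
  have e2 : MeasurableSet ((fun x => (qS act q S x, yk π V k x)) ⁻¹' {v}) :=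
    ((hs.qS_MF hq S).pair (hs.hy k)) v
  refine (abs_measureReal_sub_le_measureReal_symmDiff e1.nullMeasurableSet e2.nullMeasurableSet).trans ?_
  calc _ ≤ ν.real (⋃ s ∈ S, act s ⁻¹' {x | p n x ≠ q x}) := by
        refine measureReal_mono ?_ (measure_ne_top _ _)
        intro x hx
        by_contra hcon
        simp only [mem_iUnion, mem_preimage, mem_ofPred_eq, not_exists, not_not] at hcon
        have : qS act (p n) S x = qS act q S x := by
          ext s; exact hcon s.1 s.2
        simp [mem_symmDiff, this] at hx
    _ ≤ ∑ s ∈ S, ν.real (act s ⁻¹' {x | p n x ≠ q x}) := measureReal_biUnion_finset_le _ _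
    _ = ∑ s ∈ S, ν.real {x | p n x ≠ q x} := by
        refine Finset.sum_congr rfl fun s _ => ?_
        rw [← map_measureReal_apply (hs.hact s) ((hp n).ne_meas hq), hν]
    _ = _ := by rw [Finset.sum_const, nsmul_eq_mul]

/-- dense countable family -/
def IsDense (W : ι → Set X) (D : ℕ → X → ι) : Prop :=
  (∀ d, Adm W (D d)) ∧ ∀ (ν : Measure X) [IsFiniteMeasure ν] (q : X → ι),
      Adm W q → ∀ ε > 0, ∃ d, ν.real {x | D d x ≠ q x} < ε

def hp (lam : Measure ℝ) (act : G → X → X) (π : X → Y) (V : ℕ → Set Y) (D : ℕ → X → ι)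
    (ν : Measure X) : ℝ := ⨅ z : ℕ × KT G, bb lam act π V ν (D z.1) z.2

lemma Sys.hp_bdd (hs : Sys act actY π V) {lam : Measure ℝ} (hlam : IsCoeffMeasure lam)
    {W : ι → Set X} {D : ℕ → X → ι} (hD : IsDense W D)
    (ν : Measure X) [IsFiniteMeasure ν] :
    BddBelow (range fun z : ℕ × KT G => bb lam act π V ν (D z.1) z.2) :=
  ⟨0, by rintro _ ⟨z, rfl⟩; exact hs.bb_nonneg hlam ν (hD.1 _).1 _⟩

lemma Sys.hp_le (hs : Sys act actY π V) {lam : Measure ℝ} (hlam : IsCoeffMeasure lam)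
    {W : ι → Set X} {D : ℕ → X → ι} (hD : IsDense W D)
    (ν : Measure X) [IsFiniteMeasure ν] (hν : ∀ g, Measure.map (act g) ν = ν) {q : X → ι}
    (hq : Adm W q) (t : KT G) : hp lam act π V D ν ≤ bb lam act π V ν q t := by
  choose d hd using fun n : ℕ => hD.2 ν q hq (1 / ((n : ℝ) + 1)) (by positivity)
  have h1 : Tendsto (fun n => ν.real {x | D (d n) x ≠ q x}) atTop (nhds 0) :=
    squeeze_zero (fun _ => measureReal_nonneg) (fun n => (hd n).le) tendsto_one_div_add_atTop_nhds_zero_nat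
  exact ge_of_tendsto' (hs.bb_tendsto_q (lam := lam) ν hν (fun n => (hD.1 (d n)).1) hq.1 h1 t)
    fun n => ciInf_le (hs.hp_bdd hlam hD ν) (d n, t)

lemma Sys.bb_map_le (hs : Sys act actY π V) {lam : Measure ℝ} (hlam : IsCoeffMeasure lam)
    (ν : Measure X) [IsFiniteMeasure ν] {q : X → ι} (hq : MF q) (r : ι → κ) (t : KT G) :
    bb lam act π V ν (fun x => r (q x)) t ≤ bb lam act π V ν q t := by
  refine div_le_div_of_nonneg_right (aF_mono hlam (fun S => ?_) _) (by positivity)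
  exact Hc_map_le ν (hs.qS_MF hq S) (hs.hy _) (fun v => fun s => r (v s))

lemma Sys.plus_eq (hs : Sys act actY π V) {lam : Measure ℝ} (hlam : IsCoeffMeasure lam)
    {U : Finset (Set X)} {D : ℕ → X → U} (hD : IsDense (fun i : U => (i : Set X)) D)
    (ν : Measure X) [IsFiniteMeasure ν] (hν : ∀ g, Measure.map (act g) ν = ν)
    {F : ℕ → Finset G} (hF : IsFolner F) :
    AscCondPlus ν π (coeff lam) act U F = hp lam act π V D ν := by
  classical
  have hne : Nonempty {K : Finset G // K.Nonempty} := ⟨⟨F 0, hF.1 0⟩⟩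
  have hmem : ∀ q, Adm (fun i : U => (i : Set X)) q →
      (⨅ t : KT G, bb lam act π V ν q t) ∈
      {h | ∃ α, IsMPartition (X := X) α ∧ Refines α U ∧ h = AscCondPart ν π (coeff lam) act α F} := by
    intro q hq
    refine ⟨part q, ⟨?_, ?_, ?_⟩, ?_, (hs.asc_part hlam ν hν hq.1 hF).2.symm⟩
    · unfold IsCover
      rw [eq_univ_iff_forall]
      intro x
      exact ⟨q ⁻¹' {q x}, by simp [part], rfl⟩
    · intro A hA
      simp only [part, Finset.mem_image, Finset.mem_univ, true_and] at hA
      obtain ⟨i, rfl⟩ := hA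
      exact hq.1 i
    · intro A hA B hB hAB
      simp only [part, Finset.mem_image, Finset.mem_univ, true_and] at hA hB
      obtain ⟨i, rfl⟩ := hA
      obtain ⟨j, rfl⟩ := hB
      refine Disjoint.preimage _ (disjoint_singleton.2 ?_)
      rintro rfl; exact hAB rfl
    · intro A hA
      simp only [part, Finset.mem_image, Finset.mem_univ, true_and] at hA
      obtain ⟨i, rfl⟩ := hA
      refine ⟨i, i.2, ?_⟩
      rintro x rfl
      exact hq.2 x
  have hlow : ∀ h ∈ {h | ∃ α, IsMPartition (X := X) α ∧ Refines α U ∧ h = AscCondPart ν π (coeff lam) act α F},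
      hp lam act π V D ν ≤ h := by
    rintro _ ⟨α, ⟨hc, hm, hd⟩, hr, rfl⟩
    have hc' : ∀ x, ∃ A : α, x ∈ (A : Set X) := by
      intro x
      have : x ∈ ⋃₀ (α : Set (Set X)) := by rw [hc]; trivial
      obtain ⟨A, hA, hx⟩ := this
      exact ⟨⟨A, hA⟩, hx⟩
    choose lab hlab using hc'
    have hfib : ∀ A : α, lab ⁻¹' {A} = (A : Set X) := by
      intro A
      ext x
      constructor
      · rintro rfl; exact hlab x
      · intro hx
        by_contra hcon
        have : (lab x : Set X) ≠ A := fun h => hcon (Subtype.ext h)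
        exact (hd _ (lab x).2 _ A.2 this).le_bot ⟨hlab x, hx⟩
    have hlm : MF lab := fun A => by rw [hfib]; exact hm _ A.2
    have hpart : part lab = α := by
      ext A
      simp only [part, Finset.mem_image, Finset.mem_univ, true_and, hfib]
      constructor
      · rintro ⟨B, rfl⟩; exact B.2
      · intro h; exact ⟨⟨A, h⟩, rfl⟩
    rw [← hpart, (hs.asc_part hlam ν hν hlm hF).2]
    refine le_ciInf fun t => ?_
    choose r hrU hr using fun A : α => hr A A.2
    have hq : Adm (fun i : U => (i : Set X)) (fun x => (⟨r (lab x), hrU _⟩ : U)) :=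
      ⟨hlm.map fun A => (⟨r A, hrU _⟩ : U), fun x => hr _ (hlab x)⟩
    exact (hs.hp_le hlam hD ν hν hq t).trans
      (hs.bb_map_le hlam ν hlm (fun A => (⟨r A, hrU _⟩ : U)) t)
  unfold AscCondPlus
  apply le_antisymm
  · refine le_ciInf fun z => ?_
    refine (csInf_le ⟨_, hlow⟩ (hmem _ (hD.1 z.1))).trans ?_
    exact ciInf_le ⟨0, by rintro _ ⟨t, rfl⟩; exact hs.bb_nonneg hlam ν (hD.1 _).1 t⟩ z.2
  · exact le_csInf ⟨_, hmem _ (hD.1 0)⟩ hlow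

end Adm

end AscPf

namespace AscPf

set_option linter.unusedSectionVars false
set_option linter.unusedVariables false

section Low

variable {G X Y ι κ Ω : Type*} [MeasurableSpace X] [MeasurableSpace Y] [MeasurableSpace Ω]
  [Fintype ι] [Fintype κ] [Group G] [DecidableEq G]
variable {act : G → X → X} {actY : G → Y → Y} {π : X → Y} {V : ℕ → Set Y}
variable {m : Measure Ω} {μ : Measure X} {μω : Ω → Measure X}

def Cb (lam : Measure ℝ) (ι : Type*) [Fintype ι] (t : KT G) : ℝ :=
  aF lam (fun S => (Fintype.card ((S → ι) × (Fin t.2 → Bool)) : ℝ)) t.1.1 / (t.1.1.card : ℝ)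

lemma bb_le {lam : Measure ℝ} (hlam : IsCoeffMeasure lam)
    (ν : Measure X) [IsProbabilityMeasure ν] (q : X → ι) (t : KT G) :
    bb lam act π V ν q t ≤ Cb lam ι t :=
  div_le_div_of_nonneg_right (aF_mono hlam (fun _ => Hc_le ν _ _) _) (by positivity)

lemma Dis.meas_bb (Di : Dis m μ μω) (hs : Sys act actY π V) {lam : Measure ℝ} {q : X → ι}
    (hq : MF q) (t : KT G) : Measurable (fun ω => bb lam act π V (μω ω) q t) := by
  unfold bb aF
  exact (Finset.measurable_fun_sum _ fun S _ => (Di.meas_Hc (hs.qS_MF hq S) (hs.hy _)).const_mul _).div_const _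

lemma Dis.meas_hp [Countable G] (Di : Dis m μ μω) (hs : Sys act actY π V) {lam : Measure ℝ}
    (hlam : IsCoeffMeasure lam) {W : ι → Set X} {D : ℕ → X → ι} (hD : IsDense W D) :
    Measurable (fun ω => hp lam act π V D (μω ω)) := by
  unfold hp
  exact Measurable.iInf (fun z => Di.meas_bb hs (hD.1 _).1 _)

lemma Sys.hp_nonneg (hs : Sys act actY π V) {lam : Measure ℝ} (hlam : IsCoeffMeasure lam)
    {W : ι → Set X} {D : ℕ → X → ι} (hD : IsDense W D)
    (ν : Measure X) [IsFiniteMeasure ν] : 0 ≤ hp lam act π V D ν :=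
  Real.iInf_nonneg fun z => hs.bb_nonneg hlam ν (hD.1 _).1 _

lemma Sys.hp_le_Cb (hs : Sys act actY π V) {lam : Measure ℝ} (hlam : IsCoeffMeasure lam)
    {W : ι → Set X} {D : ℕ → X → ι} (hD : IsDense W D)
    (ν : Measure X) [IsProbabilityMeasure ν] (t : KT G) : hp lam act π V D ν ≤ Cb lam ι t :=
  (ciInf_le (hs.hp_bdd hlam hD ν) (0, t)).trans (bb_le hlam ν _ _)

lemma Dis.int_hp [Countable G] (Di : Dis m μ μω) (hs : Sys act actY π V) {lam : Measure ℝ}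
    (hlam : IsCoeffMeasure lam) {W : ι → Set X} {D : ℕ → X → ι} (hD : IsDense W D) (t : KT G) :
    Integrable (fun ω => hp lam act π V D (μω ω)) m := by
  have := Di.hm
  have := Di.hprob
  refine Integrable.of_bound (Di.meas_hp hs hlam hD).aestronglyMeasurable (Cb lam ι t) ?_
  refine Eventually.of_forall fun ω => ?_
  rw [Real.norm_eq_abs, abs_of_nonneg (hs.hp_nonneg hlam hD _)]
  exact hs.hp_le_Cb hlam hD _ t

lemma Dis.lower [Countable G] (Di : Dis m μ μω) (hs : Sys act actY π V) {lam : Measure ℝ}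
    (hlam : IsCoeffMeasure lam) {W : ι → Set X} {D : ℕ → X → ι} (hD : IsDense W D) [Nonempty (KT G)] :
    ∫ ω, hp lam act π V D (μω ω) ∂m ≤ hp lam act π V D μ := by
  have := Di.hm
  have := Di.hprob
  refine le_ciInf fun z => ?_
  have hq := (hD.1 z.1).1
  have hi : ∀ S, Integrable (fun ω => Hc (μω ω) (qS act (D z.1) S) (yk π V z.2.2)) m :=
    fun S => Di.int_Hc (hs.qS_MF hq S) (hs.hy _)
  have hb : Integrable (fun ω => bb lam act π V (μω ω) (D z.1) z.2) m :=
    (integrable_finsetSum _ fun S _ => (hi S).const_mul _).div_const _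
  calc ∫ ω, hp lam act π V D (μω ω) ∂m ≤ ∫ ω, bb lam act π V (μω ω) (D z.1) z.2 ∂m :=
        integral_mono (Di.int_hp hs hlam hD z.2) hb fun ω => ciInf_le (hs.hp_bdd hlam hD _) z
    _ = aF lam (fun S => ∫ ω, Hc (μω ω) (qS act (D z.1) S) (yk π V z.2.2) ∂m) z.2.1.1 / (z.2.1.1.card : ℝ) := by
        unfold bb aF
        rw [integral_div, integral_finsetSum _ fun S _ => (hi S).const_mul _]
        simp_rw [integral_const_mul]
    _ ≤ _ := div_le_div_of_nonneg_right (aF_mono hlam (fun S => Di.Hc_concave (hs.qS_MF hq S) (hs.hy _)) _) (by positivity)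

end Low

end AscPf

namespace AscPf

set_option linter.unusedSectionVars false

section Erg

variable {G X Ω : Type*} [MeasurableSpace X] [MeasurableSpace Ω] [Group G] [Countable G]
variable {act : G → X → X}
variable {m : Measure Ω} {μ : Measure X} {μω : Ω → Measure X}

lemma Dis.ae (Di : Dis m μ μω) {P : X → Prop} (h : ∀ᵐ x ∂μ, P x) :
    ∀ᵐ ω ∂m, ∀ᵐ x ∂(μω ω), P x := by
  have h0 : μ (toMeasurable μ {x | ¬ P x}) = 0 := by
    rw [measure_toMeasurable]; exact h
  rw [Di.hdis _ (measurableSet_toMeasurable _ _), lintegral_eq_zero_iff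
    (Di.hmeas _ (measurableSet_toMeasurable _ _))] at h0
  filter_upwards [h0] with ω hω
  exact measure_mono_null (subset_toMeasurable _ _) hω

/-- good representatives -/
structure Good (m : Measure Ω) (μω : Ω → Measure X) (B : Set X) (f : X → ℝ) : Prop where
  meas : Measurable f
  nonneg : ∀ x, 0 ≤ f x
  le_one : ∀ x, f x ≤ 1
  int : ∀ᵐ ω ∂m, ∫ x, f x ∂(μω ω) = (μω ω).real B

lemma Good.integrable {B : Set X} {f : X → ℝ} (hf : Good m μω B f) (ν : Measure X)
    [IsFiniteMeasure ν] : Integrable f ν :=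
  Integrable.of_bound hf.meas.aestronglyMeasurable 1 (Eventually.of_forall fun x => by
    rw [Real.norm_eq_abs, abs_of_nonneg (hf.nonneg x)]; exact hf.le_one x)

def CC (m : Measure Ω) (μ : Measure X) (μω : Ω → Measure X) (B : Set X) : Set (Lp ℝ 2 μ) :=
  {f | ∃ f' : X → ℝ, Good m μω B f' ∧ f =ᵐ[μ] f'}

lemma CC_nonempty (Di : Dis m μ μω) {B : Set X} (hB : MeasurableSet B) :
    (CC m μ μω B).Nonempty := by
  have := Di.hμ
  have := Di.hprob
  have hm : Measurable (B.indicator (fun _ => (1 : ℝ))) := measurable_const.indicator hB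
  have hg : Good m μω B (B.indicator (fun _ => (1 : ℝ))) := by
    refine ⟨hm, fun x => indicator_nonneg (fun _ _ => zero_le_one) x,
      fun x => indicator_le_self' (fun _ _ => zero_le_one) x, Eventually.of_forall fun ω => ?_⟩
    simp [integral_indicator hB]
  have hL : MemLp (B.indicator (fun _ => (1 : ℝ))) 2 μ :=
    MemLp.of_bound hm.aestronglyMeasurable 1 (Eventually.of_forall fun x => by
      rw [Real.norm_eq_abs, abs_of_nonneg (hg.nonneg x)]; exact hg.le_one x)
  exact ⟨hL.toLp _, _, hg, hL.coeFn_toLp⟩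

lemma CC_convex (Di : Dis m μ μω) (B : Set X) : Convex ℝ (CC m μ μω B) := by
  have := Di.hprob
  rintro f ⟨f', hf, hf'⟩ g ⟨g', hg, hg'⟩ a b ha hb hab
  refine ⟨fun x => a * f' x + b * g' x, ⟨?_, ?_, ?_, ?_⟩, ?_⟩
  · exact (hf.meas.const_mul a).add (hg.meas.const_mul b)
  · intro x
    have := hf.nonneg x
    have := hg.nonneg x
    positivity
  · intro x
    have h1 := mul_le_mul_of_nonneg_left (hf.le_one x) ha
    have h2 := mul_le_mul_of_nonneg_left (hg.le_one x) hb
    linarith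
  · filter_upwards [hf.int, hg.int] with ω h1 h2
    rw [integral_add ((hf.integrable _).const_mul a) ((hg.integrable _).const_mul b),
      integral_const_mul, integral_const_mul, h1, h2, ← add_mul, hab, one_mul]
  · filter_upwards [Lp.coeFn_add (a • f) (b • g), Lp.coeFn_smul a f, Lp.coeFn_smul b g, hf', hg']
      with x h1 h2 h3 h4 h5
    rw [h1, Pi.add_apply, h2, h3, Pi.smul_apply, Pi.smul_apply, h4, h5]
    simp

lemma CC_closed (Di : Dis m μ μω) (B : Set X) : IsClosed (CC m μ μω B) := by
  have := Di.hprob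
  rw [← isSeqClosed_iff_isClosed]
  intro f v hf hv
  choose f' hg hff using hf
  obtain ⟨ns, -, hns⟩ := (tendstoInMeasure_of_tendsto_Lp hv).exists_seq_tendsto_ae
  set u := (Lp.aestronglyMeasurable v).mk v with hu
  have hum : Measurable u := (Lp.aestronglyMeasurable v).stronglyMeasurable_mk.measurable
  have huv : v =ᵐ[μ] u := (Lp.aestronglyMeasurable v).ae_eq_mk
  set w : X → ℝ := fun x => max 0 (min 1 (u x)) with hw
  have hwm : Measurable w := measurable_const.max (measurable_const.min hum)
  have hfa : ∀ᵐ x ∂μ, ∀ n, f n x = f' n x := ae_all_iff.2 hff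
  have hlim : ∀ᵐ x ∂μ, v x = w x ∧ Tendsto (fun i => f' (ns i) x) atTop (nhds (w x)) := by
    filter_upwards [hns, huv, hfa] with x h1 h2 h3
    have h4 : Tendsto (fun i => f' (ns i) x) atTop (nhds (u x)) := by
      rw [← h2]; exact h1.congr fun i => h3 _
    have h5 : 0 ≤ u x := ge_of_tendsto' h4 fun i => (hg _).nonneg x
    have h6 : u x ≤ 1 := le_of_tendsto' h4 fun i => (hg _).le_one x
    have h7 : w x = u x := by simp [hw, h5, h6]
    rw [h7]
    exact ⟨h2, h4⟩
  refine ⟨w, ⟨hwm, fun x => le_max_left _ _, fun x => max_le zero_le_one (min_le_left _ _), ?_⟩,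
    hlim.mono fun x h => h.1⟩
  have hall : ∀ᵐ ω ∂m, ∀ n, ∫ x, f' n x ∂(μω ω) = (μω ω).real B := ae_all_iff.2 fun n => (hg n).int
  filter_upwards [hall, Di.ae hlim] with ω h1 h2
  have := tendsto_integral_of_dominated_convergence (μ := μω ω) (F := fun i => f' (ns i)) (f := w) (fun _ => 1)
    (fun n => (hg _).meas.aestronglyMeasurable) (integrable_const _)
    (fun n => Eventually.of_forall fun x => by
      rw [Real.norm_eq_abs, abs_of_nonneg ((hg _).nonneg x)]; exact (hg _).le_one x)
    (h2.mono fun x h => h.2)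
  simp_rw [h1] at this
  exact tendsto_nhds_unique this tendsto_const_nhds

lemma mean_erg (Di : Dis m μ μω) (hact : ∀ g, Measurable (act g))
    (hactm : ∀ g h x, act (g * h) x = act g (act h x))
    (hinv : ∀ g, Measure.map (act g) μ = μ) (hinvω : ∀ ω g, Measure.map (act g) (μω ω) = μω ω)
    {B : Set X} (hB : MeasurableSet B) :
    ∃ f : X → ℝ, Good m μω B f ∧ ∀ g x, f (act g x) = f x := by
  have := Di.hμ
  have hmp : ∀ g, MeasurePreserving (act g) μ μ := fun g => ⟨hact g, hinv g⟩
  obtain ⟨v, hvC, hv⟩ := exists_norm_eq_iInf_of_complete_convex (CC_nonempty Di hB)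
    (CC_closed Di B).isComplete (CC_convex Di B) 0
  rw [norm_eq_iInf_iff_real_inner_le_zero (CC_convex Di B) hvC] at hv
  have hT : ∀ g, Lp.compMeasurePreserving (act g) (hmp g) v = v := by
    intro g
    set w := Lp.compMeasurePreserving (act g) (hmp g) v with hw
    have hnw : ‖w‖ = ‖v‖ := Lp.norm_compMeasurePreserving v (hmp g)
    have hwC : w ∈ CC m μ μω B := by
      obtain ⟨f', hf, hvf⟩ := hvC
      refine ⟨fun x => f' (act g x), ⟨hf.meas.comp (hact g), fun x => hf.nonneg _,
        fun x => hf.le_one _, ?_⟩, ?_⟩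
      · filter_upwards [hf.int] with ω hω
        rw [← hω]
        conv_rhs => rw [← hinvω ω g]
        rw [integral_map (hact g).aemeasurable hf.meas.aestronglyMeasurable]
      · exact (Lp.coeFn_compMeasurePreserving v (hmp g)).trans
          ((hmp g).quasiMeasurePreserving.ae_eq_comp hvf)
    have h1 := hv w hwC
    have h2 : ‖w - v‖ ^ 2 ≤ 0 := by
      rw [@norm_sub_sq_real]
      rw [zero_sub, inner_neg_left, inner_sub_right, real_inner_self_eq_norm_sq,
        real_inner_comm] at h1
      rw [hnw]; linarith
    have h3 : ‖w - v‖ = 0 := by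
      have := sq_nonneg ‖w - v‖
      exact pow_eq_zero_iff (two_ne_zero) |>.1 (le_antisymm h2 this)
    exact sub_eq_zero.1 (norm_eq_zero.1 h3)
  obtain ⟨f', hf, hvf⟩ := hvC
  have hfi : ∀ᵐ x ∂μ, ∀ g, f' (act g x) = f' x := by
    refine ae_all_iff.2 fun g => ?_
    have h1 := Lp.coeFn_compMeasurePreserving v (hmp g)
    rw [hT g] at h1
    filter_upwards [h1, hvf, (hmp g).quasiMeasurePreserving.ae_eq_comp hvf] with x a b c
    rw [← b, a, c]; rfl
  have hbd : ∀ x, BddAbove (range fun h : G => f' (act h x)) :=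
    fun x => ⟨1, by rintro _ ⟨h, rfl⟩; exact hf.le_one _⟩
  refine ⟨fun x => ⨆ h : G, f' (act h x), ⟨?_, ?_, ?_, ?_⟩, ?_⟩
  · exact Measurable.iSup fun h => hf.meas.comp (hact h)
  · exact fun x => Real.iSup_nonneg fun h => hf.nonneg _
  · exact fun x => ciSup_le fun h => hf.le_one _
  · filter_upwards [hf.int, Di.ae hfi] with ω h1 h2
    rw [← h1]
    refine integral_congr_ae ?_
    filter_upwards [h2] with x hx
    simp [hx]
  · intro g x
    simp only [← hactm]
    exact (Equiv.mulRight g).iSup_congr fun h => rfl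

end Erg

end AscPf

namespace AscPf

set_option linter.unusedSectionVars false

section Glue

variable {G X Y ι J : Type*} [MeasurableSpace X] [MeasurableSpace Y]
  [Fintype ι] [Fintype J] [Group G] [DecidableEq G] [Infinite G]
variable {act : G → X → X} {actY : G → Y → Y} {π : X → Y} {V : ℕ → Set Y}
variable {μ : Measure X}

lemma cond_inv {T : X → X} (hT : Measurable T) (hμ : Measure.map T μ = μ) {s : Set X}
    (hs : MeasurableSet s) (h : T ⁻¹' s = s) :
    Measure.map T (ProbabilityTheory.cond μ s) = ProbabilityTheory.cond μ s := by
  unfold ProbabilityTheory.cond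
  rw [Measure.map_smul]
  congr 1
  conv_lhs => rw [← h]
  rw [← Measure.restrict_map hT hs, hμ]

lemma sum_fib (μ : Measure X) [IsProbabilityMeasure μ] {c : X → J} (hc : MF c) :
    ∑ j, μ.real (c ⁻¹' {j}) = 1 := by
  rw [sum_measureReal_preimage_singleton _ (fun j _ => hc j)]
  simp

lemma Sys.glue (hs : Sys act actY π V) {lam : Measure ℝ} (hlam : IsCoeffMeasure lam)
    [IsProbabilityMeasure μ] (hμ : ∀ g, Measure.map (act g) μ = μ)
    {F : ℕ → Finset G} (hF : IsFolner F) {W : ι → Set X} {D : ℕ → X → ι} (hD : IsDense W D)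
    {c : X → J} (hc : MF c) (hcinv : ∀ g x, c (act g x) = c x) {q : J → X → ι}
    (hq : ∀ j, Adm W (q j)) :
    hp lam act π V D μ ≤ ∑ j, μ.real (c ⁻¹' {j}) *
      ⨅ t : KT G, bb lam act π V (ProbabilityTheory.cond μ (c ⁻¹' {j})) (q j) t := by
  have hne : Nonempty {K : Finset G // K.Nonempty} := ⟨⟨F 0, hF.1 0⟩⟩
  set Q : X → ι := fun x => q (c x) x with hQ
  have hQm : MF Q := by
    intro i
    have : Q ⁻¹' {i} = ⋃ j, (c ⁻¹' {j} ∩ q j ⁻¹' {i}) := by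
      ext x; simp [hQ]
    rw [this]
    exact MeasurableSet.iUnion fun j => (hc j).inter ((hq j).1 i)
  have hQa : Adm W Q := ⟨hQm, fun x => (hq _).2 x⟩
  have hinvj : ∀ j g, Measure.map (act g) (ProbabilityTheory.cond μ (c ⁻¹' {j})) =
      ProbabilityTheory.cond μ (c ⁻¹' {j}) := fun j g =>
    cond_inv (hs.hact g) (hμ g) (hc j) (by ext x; simp [hcinv])
  have hCE : ∀ S : Finset G, CE μ π (qS act Q S) ≤ Hn μ c + ∑ j, μ.real (c ⁻¹' {j}) *
      CE (ProbabilityTheory.cond μ (c ⁻¹' {j})) π (qS act (q j) S) := by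
    intro S
    refine le_of_tendsto_of_tendsto' (levy μ hs.hπ hs.hgen (hs.qS_MF hQm S))
      (tendsto_const_nhds.add (tendsto_finsetSum _ fun j _ => Tendsto.const_mul _
        (levy (ProbabilityTheory.cond μ (c ⁻¹' {j})) hs.hπ hs.hgen (hs.qS_MF (hq j).1 S)))) fun k => ?_
    refine (Hc_decomp μ (hs.qS_MF hQm S) (hs.hy k) hc).trans (le_of_eq ?_)
    congr 1
    refine Finset.sum_congr rfl fun j _ => ?_
    congr 1
    refine Hc_congr _ _ ?_
    filter_upwards [ProbabilityTheory.ae_cond_mem (μ := μ) (hc j)] with x hx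
    ext s
    have hx : c x = j := hx
    simp [qS, hQ, hcinv, hx]
  have h1 := (hs.asc_part hlam μ hμ hQm hF).1
  have h2 := fun j => (hs.asc_part hlam (ProbabilityTheory.cond μ (c ⁻¹' {j})) (hinvj j) (hq j).1 hF).1
  have h3 : Tendsto (fun n => Hn μ c / ((F n).card : ℝ) + ∑ j, μ.real (c ⁻¹' {j}) *
      (aF lam (fun S => CE (ProbabilityTheory.cond μ (c ⁻¹' {j})) π (qS act (q j) S)) (F n) / (F n).card))
      atTop (nhds (0 + ∑ j, μ.real (c ⁻¹' {j}) *
      ⨅ t : KT G, bb lam act π V (ProbabilityTheory.cond μ (c ⁻¹' {j})) (q j) t)) :=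
    (Tendsto.div_atTop tendsto_const_nhds (folner_card hF)).add
      (tendsto_finsetSum _ fun j _ => (h2 j).const_mul _)
  rw [zero_add] at h3
  refine (le_ciInf fun t => hs.hp_le hlam hD μ hμ hQa t).trans ?_
  refine le_of_tendsto_of_tendsto' h1 h3 fun n => ?_
  have h4 : aF lam (fun S => CE μ π (qS act Q S)) (F n) ≤ Hn μ c + ∑ j, μ.real (c ⁻¹' {j}) *
      aF lam (fun S => CE (ProbabilityTheory.cond μ (c ⁻¹' {j})) π (qS act (q j) S)) (F n) := by
    refine (aF_mono hlam hCE _).trans (le_of_eq ?_)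
    unfold aF
    simp_rw [mul_add, Finset.sum_add_distrib, ← Finset.sum_mul, coeff_sum hlam, one_mul, Finset.mul_sum]
    congr 1
    rw [Finset.sum_comm]
    refine Finset.sum_congr rfl fun j _ => Finset.sum_congr rfl fun S _ => by ring
  refine (div_le_div_of_nonneg_right h4 (by positivity)).trans (le_of_eq ?_)
  rw [add_div, Finset.sum_div]
  congr 1
  exact Finset.sum_congr rfl fun j _ => by ring

lemma Sys.upper (hs : Sys act actY π V) {lam : Measure ℝ} (hlam : IsCoeffMeasure lam)
    [IsProbabilityMeasure μ] (hμ : ∀ g, Measure.map (act g) μ = μ)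
    {F : ℕ → Finset G} (hF : IsFolner F) {W : ι → Set X} {D : ℕ → X → ι} (hD : IsDense W D)
    {c : X → J} (hc : MF c) (hcinv : ∀ g x, c (act g x) = c x) :
    hp lam act π V D μ ≤ ∑ j, μ.real (c ⁻¹' {j}) *
      hp lam act π V D (ProbabilityTheory.cond μ (c ⁻¹' {j})) := by
  have hne : Nonempty {K : Finset G // K.Nonempty} := ⟨⟨F 0, hF.1 0⟩⟩
  refine le_of_forall_pos_le_add fun ε hε => ?_
  have : ∀ j, ∃ z : ℕ × KT G, bb lam act π V (ProbabilityTheory.cond μ (c ⁻¹' {j})) (D z.1) z.2 <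
      hp lam act π V D (ProbabilityTheory.cond μ (c ⁻¹' {j})) + ε :=
    fun j => exists_lt_of_ciInf_lt (lt_add_of_pos_right _ hε)
  choose z hz using this
  refine (hs.glue hlam hμ hF hD hc hcinv (q := fun j => D (z j).1) (fun j => hD.1 _)).trans ?_
  calc _ ≤ ∑ j, μ.real (c ⁻¹' {j}) * (hp lam act π V D (ProbabilityTheory.cond μ (c ⁻¹' {j})) + ε) := by
        refine Finset.sum_le_sum fun j _ => mul_le_mul_of_nonneg_left ?_ measureReal_nonneg
        refine (ciInf_le ⟨0, ?_⟩ (z j).2).trans (hz j).le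
        rintro _ ⟨t, rfl⟩
        exact hs.bb_nonneg hlam _ (hD.1 _).1 t
    _ = _ := by
        simp_rw [mul_add, Finset.sum_add_distrib, ← Finset.sum_mul, sum_fib μ hc, one_mul]

end Glue

end AscPf

namespace AscPf

set_option linter.unusedSectionVars false

section Fin

variable {G X Y Ω ι : Type*} [MeasurableSpace X] [MeasurableSpace Y] [MeasurableSpace Ω]
  [Fintype ι] [Group G] [DecidableEq G] [Infinite G] [Countable G]
variable {act : G → X → X} {actY : G → Y → Y} {π : X → Y} {V : ℕ → Set Y}
variable {m : Measure Ω} {μ : Measure X} {μω : Ω → Measure X}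

/-- quantization -/
def cN (g : ℕ → X → ℝ) (N : ℕ) (x : X) : Fin N → Fin (N + 1) :=
  fun i => Fin.ofNat (N + 1) ⌊(N : ℝ) * g i x⌋₊

lemma cN_inv {g : ℕ → X → ℝ} (hgi : ∀ i a x, g i (act a x) = g i x) (N : ℕ) (a : G) (x : X) :
    cN g N (act a x) = cN g N x := by
  funext i
  simp only [cN, hgi]

lemma cN_MF {g : ℕ → X → ℝ} (hg : ∀ i, Measurable (g i)) (N : ℕ) : MF (cN g N) := by
  intro v
  have : cN g N ⁻¹' {v} = ⋂ i : Fin N, (fun x => Fin.ofNat (N + 1) ⌊(N : ℝ) * g i x⌋₊) ⁻¹' {v i} := by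
    ext x; simp [cN, funext_iff]
  rw [this]
  refine MeasurableSet.iInter fun i => ?_
  have h1 : Measurable (fun x => ⌊(N : ℝ) * g i x⌋₊) := Nat.measurable_floor.comp ((hg i).const_mul _)
  exact ((measurable_from_top (f := fun n : ℕ => Fin.ofNat (N + 1) n)).comp h1)
    (MeasurableSet.singleton (v i))

lemma cN_bd {g : ℕ → X → ℝ} {N : ℕ} (hN : 0 < N) (h0 : ∀ i x, 0 ≤ g i x) (h1 : ∀ i x, g i x ≤ 1)
    {x : X} {v : Fin N → Fin (N + 1)} (h : cN g N x = v) (i : Fin N) :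
    ((v i : ℕ) : ℝ) / N ≤ g i x ∧ g i x ≤ ((v i : ℕ) : ℝ) / N + 1 / N := by
  have hN' : (0 : ℝ) < N := by exact_mod_cast hN
  have hx : 0 ≤ (N : ℝ) * g i x := mul_nonneg hN'.le (h0 _ _)
  have hlt : ⌊(N : ℝ) * g i x⌋₊ < N + 1 := by
    rw [Nat.floor_lt hx]
    have := mul_le_mul_of_nonneg_left (h1 i x) hN'.le
    push_cast; linarith
  have hv : (v i : ℕ) = ⌊(N : ℝ) * g i x⌋₊ := by
    rw [← h]
    simp [cN, Fin.ofNat, Nat.mod_eq_of_lt hlt]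
  rw [hv]
  constructor
  · rw [div_le_iff₀ hN', mul_comm (g _ x)]; exact Nat.floor_le hx
  · rw [← add_div, le_div_iff₀ hN', mul_comm (g _ x)]; exact (Nat.lt_floor_add_one _).le

lemma approx (Di : Dis m μ μω) (hact : ∀ g, Measurable (act g))
    (herg : ∀ ω, IsErgodicAct act (μω ω)) {B : ℕ → Set X} (hB : ∀ i, MeasurableSet (B i))
    {g : ℕ → X → ℝ} (hg : ∀ i, Good m μω (B i) (g i)) (hgi : ∀ i a x, g i (act a x) = g i x)
    {N : ℕ} (hN : 0 < N) :
    ∀ᵐ ω ∂m, ∃ j, (μω ω).real (cN g N ⁻¹' {j}) = 1 ∧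
      (∀ j', j' ≠ j → (μω ω).real (cN g N ⁻¹' {j'}) = 0) ∧ μ (cN g N ⁻¹' {j}) ≠ 0 ∧
      ∀ i : Fin N, |(ProbabilityTheory.cond μ (cN g N ⁻¹' {j})).real (B i) - (μω ω).real (B i)| ≤ 1 / N := by
  have := Di.hμ
  have := Di.hm
  have := Di.hprob
  have hc : MF (cN g N) := cN_MF (fun i => (hg i).meas) N
  have h01 : ∀ ω j, (μω ω).real (cN g N ⁻¹' {j}) = 0 ∨ (μω ω).real (cN g N ⁻¹' {j}) = 1 := by
    intro ω j
    rcases (herg ω).2 _ (hc j) (fun a => by ext x; simp [cN_inv hgi]) with h | h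
    · left; simp [measureReal_def, h]
    · right; simp [measureReal_def, h]
  -- on mass one pieces the measure of `B i` is pinned
  have hpin : ∀ᵐ ω ∂m, ∀ (i : Fin N) (j : Fin N → Fin (N + 1)), (μω ω).real (cN g N ⁻¹' {j}) = 1 →
      ((j i : ℕ) : ℝ) / N ≤ (μω ω).real (B i) ∧ (μω ω).real (B i) ≤ ((j i : ℕ) : ℝ) / N + 1 / N := by
    have hall : ∀ᵐ ω ∂m, ∀ i, ∫ x, g i x ∂(μω ω) = (μω ω).real (B i) := ae_all_iff.2 fun i => (hg i).int
    filter_upwards [hall] with ω hω i j hj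
    rw [← hω i]
    have hae : ∀ᵐ x ∂(μω ω), cN g N x = j := by
      have h2 : (μω ω) (cN g N ⁻¹' {j}) = 1 := by
        rwa [measureReal_def, ENNReal.toReal_eq_one_iff] at hj
      exact (prob_compl_eq_zero_iff (hc j)).2 h2
    have hbd := fun x (hx : cN g N x = j) =>
      cN_bd hN (fun i x => (hg i).nonneg x) (fun i x => (hg i).le_one x) hx i
    constructor
    · have := integral_mono_ae (μ := μω ω) (integrable_const (((j i : ℕ) : ℝ) / N))
        ((hg i).integrable (μω ω)) (hae.mono fun x hx => (hbd x hx).1)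
      simpa using this
    · have := integral_mono_ae (μ := μω ω) ((hg i).integrable (μω ω))
        (integrable_const (((j i : ℕ) : ℝ) / N + 1 / N)) (hae.mono fun x hx => (hbd x hx).2)
      simpa using this
  have hinter : ∀ ω (i : ℕ) j, (μω ω).real (cN g N ⁻¹' {j}) = 1 →
      (μω ω).real (cN g N ⁻¹' {j} ∩ B i) = (μω ω).real (B i) := by
    intro ω i j hj
    have h2 : (μω ω) (cN g N ⁻¹' {j}) = 1 := by
      rwa [measureReal_def, ENNReal.toReal_eq_one_iff] at hj
    have hae : cN g N ⁻¹' {j} =ᵐ[μω ω] univ := by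
      rw [ae_eq_univ]; exact (prob_compl_eq_zero_iff (hc j)).2 h2
    refine measureReal_congr ?_
    simpa using hae.inter (ae_eq_refl (B i))
  have hint : ∀ {A : Set X}, MeasurableSet A → Integrable (fun ω => (μω ω).real A) m := fun hA =>
    Integrable.of_bound (Di.meas_real hA).aestronglyMeasurable 1 (Eventually.of_forall fun ω => by
      rw [Real.norm_eq_abs, abs_of_nonneg measureReal_nonneg]; exact measureReal_le_one)
  have hμpin : ∀ (i : Fin N) (j : Fin N → Fin (N + 1)),
      ((j i : ℕ) : ℝ) / N * μ.real (cN g N ⁻¹' {j}) ≤ μ.real (cN g N ⁻¹' {j} ∩ B i) ∧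
      μ.real (cN g N ⁻¹' {j} ∩ B i) ≤ (((j i : ℕ) : ℝ) / N + 1 / N) * μ.real (cN g N ⁻¹' {j}) := by
    intro i j
    rw [Di.real_eq (hc j), Di.real_eq ((hc j).inter (hB i)), ← integral_const_mul, ← integral_const_mul]
    constructor
    · refine integral_mono_ae ((hint (hc j)).const_mul _) (hint ((hc j).inter (hB i))) ?_
      filter_upwards [hpin] with ω hω
      rcases h01 ω j with h | h
      · simp only [h, mul_zero]; exact measureReal_nonneg
      · simp only [h, mul_one, hinter ω i j h]; exact (hω i j h).1
    · refine integral_mono_ae (hint ((hc j).inter (hB i))) ((hint (hc j)).const_mul _) ?_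
      filter_upwards [hpin] with ω hω
      rcases h01 ω j with h | h
      · simp only [h, mul_zero]; rw [← h]; exact measureReal_mono inter_subset_left
      · simp only [h, mul_one, hinter ω i j h]; exact (hω i j h).2
  have hnull : ∀ᵐ ω ∂m, ∀ j, μ (cN g N ⁻¹' {j}) = 0 → μω ω (cN g N ⁻¹' {j}) = 0 := by
    refine ae_all_iff.2 fun j => ?_
    by_cases h : μ (cN g N ⁻¹' {j}) = 0
    · have h' := h
      rw [Di.hdis _ (hc j), lintegral_eq_zero_iff (Di.hmeas _ (hc j))] at h'
      filter_upwards [h'] with ω hω _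
      exact hω
    · exact Eventually.of_forall fun ω h2 => absurd h2 h
  filter_upwards [hpin, hnull] with ω h1 h2
  have hsum := sum_fib (μω ω) hc
  have hex : ∃ j, (μω ω).real (cN g N ⁻¹' {j}) = 1 := by
    by_contra hcon
    push Not at hcon
    have : ∀ j, (μω ω).real (cN g N ⁻¹' {j}) = 0 := fun j => (h01 ω j).resolve_right (hcon j)
    simp [this] at hsum
  obtain ⟨j, hj⟩ := hex
  have hj0 : μ (cN g N ⁻¹' {j}) ≠ 0 := by
    intro h
    have := h2 j h
    simp [measureReal_def, this] at hj
  refine ⟨j, hj, ?_, hj0, ?_⟩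
  · intro j' hj'
    rcases h01 ω j' with h | h
    · exact h
    · exfalso
      have := Finset.add_le_sum (s := Finset.univ) (f := fun j => (μω ω).real (cN g N ⁻¹' {j}))
        (fun _ _ => measureReal_nonneg) (Finset.mem_univ j') (Finset.mem_univ j) hj'
      simp only [h, hj, hsum] at this
      norm_num at this
  · intro i
    have hpos : 0 < μ.real (cN g N ⁻¹' {j}) := by
      rw [measureReal_def]; exact ENNReal.toReal_pos hj0 (measure_ne_top _ _)
    have hcr : (ProbabilityTheory.cond μ (cN g N ⁻¹' {j})).real (B i) =
        μ.real (cN g N ⁻¹' {j} ∩ B i) / μ.real (cN g N ⁻¹' {j}) := by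
      rw [measureReal_def, ProbabilityTheory.cond_apply (hc j), ENNReal.toReal_mul, ENNReal.toReal_inv,
        div_eq_inv_mul]
      rfl
    obtain ⟨a1, a2⟩ := hμpin i j
    rw [← le_div_iff₀ hpos] at a1
    rw [← div_le_iff₀ hpos] at a2
    rw [← hcr] at a1 a2
    obtain ⟨b1, b2⟩ := h1 i j hj
    rw [abs_le]
    constructor <;> linarith

lemma upper_final (Di : Dis m μ μω) (hs : Sys act actY π V) {lam : Measure ℝ} (hlam : IsCoeffMeasure lam)
    (hμ : ∀ g, Measure.map (act g) μ = μ) (herg : ∀ ω, IsErgodicAct act (μω ω))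
    {F : ℕ → Finset G} (hF : IsFolner F) {W : ι → Set X} {D : ℕ → X → ι} (hD : IsDense W D) :
    hp lam act π V D μ ≤ ∫ ω, hp lam act π V D (μω ω) ∂m := by
  have := Di.hμ
  have := Di.hm
  have := Di.hprob
  have hne : Nonempty {K : Finset G // K.Nonempty} := ⟨⟨F 0, hF.1 0⟩⟩
  let t0 : KT G := Classical.arbitrary _
  let I := (Σ p : ℕ × Finset G × ℕ, ((p.2.1 → ι) × (Fin p.2.2 → Bool))) ⊕ (Σ k : ℕ, Fin k → Bool)
  have hI : Countable I := inferInstance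
  have hIne : Nonempty I := ⟨Sum.inr ⟨0, fun i => i.elim0⟩⟩
  let BI : I → Set X := fun s => Sum.rec
    (fun s => (fun x => (qS act (D s.1.1) s.1.2.1 x, yk π V s.1.2.2 x)) ⁻¹' {s.2})
    (fun s => yk π V s.1 ⁻¹' {s.2}) s
  have hBI : ∀ s, MeasurableSet (BI s) := by
    rintro (s | s)
    · exact ((hs.qS_MF (hD.1 _).1 _).pair (hs.hy _)) _
    · exact hs.hy _ _
  obtain ⟨e, he⟩ := exists_surjective_nat I
  choose g hg hgi using fun i => mean_erg (act := act) Di hs.hact hs.hactm hμ (fun ω => (herg ω).1) (hBI (e i))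
  have happ : ∀ᵐ ω ∂m, ∀ N : ℕ, ∃ j, (μω ω).real (cN g (N + 1) ⁻¹' {j}) = 1 ∧
      (∀ j', j' ≠ j → (μω ω).real (cN g (N + 1) ⁻¹' {j'}) = 0) ∧ μ (cN g (N + 1) ⁻¹' {j}) ≠ 0 ∧
      ∀ i : Fin (N + 1), |(ProbabilityTheory.cond μ (cN g (N + 1) ⁻¹' {j})).real (BI (e i)) -
        (μω ω).real (BI (e i))| ≤ 1 / ((N + 1 : ℕ) : ℝ) :=
    ae_all_iff.2 fun N => approx Di hs.hact herg (B := fun i => BI (e i)) (fun i => hBI _) hg hgi (Nat.succ_pos N)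
  let φ : ℕ → Ω → ℝ := fun N ω => ∑ j, (μω ω).real (cN g (N + 1) ⁻¹' {j}) *
    hp lam act π V D (ProbabilityTheory.cond μ (cN g (N + 1) ⁻¹' {j}))
  have hcN : ∀ N, MF (cN g N) := cN_MF fun i => (hg i).meas
  have hint : ∀ {A : Set X}, MeasurableSet A → Integrable (fun ω => (μω ω).real A) m := fun hA =>
    Integrable.of_bound (Di.meas_real hA).aestronglyMeasurable 1 (Eventually.of_forall fun ω => by
      rw [Real.norm_eq_abs, abs_of_nonneg measureReal_nonneg]; exact measureReal_le_one)
  have hφi : ∀ N, Integrable (φ N) m := fun N =>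
    integrable_finsetSum _ fun j _ => (hint (hcN (N + 1) j)).mul_const _
  have hφ1 : ∀ N, hp lam act π V D μ ≤ ∫ ω, φ N ω ∂m := by
    intro N
    refine (hs.upper hlam hμ hF hD (hcN (N + 1)) (cN_inv hgi _)).trans (le_of_eq ?_)
    rw [integral_finsetSum _ fun j _ => (hint (hcN (N + 1) j)).mul_const _]
    refine Finset.sum_congr rfl fun j _ => ?_
    rw [integral_mul_const, ← Di.real_eq (hcN _ j)]
  have hφ2 : ∀ᵐ ω ∂m, ∃ ν' : ℕ → Measure X, (∀ N, IsProbabilityMeasure (ν' N)) ∧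
      (∀ N, φ N ω = hp lam act π V D (ν' N)) ∧
      ∀ s, Tendsto (fun N => (ν' N).real (BI s)) atTop (nhds ((μω ω).real (BI s))) := by
    filter_upwards [happ] with ω hω
    choose j h1 h2 h3 h4 using hω
    refine ⟨fun N => ProbabilityTheory.cond μ (cN g (N + 1) ⁻¹' {j N}),
      fun N => ProbabilityTheory.cond_isProbabilityMeasure (h3 N), fun N => ?_, fun s => ?_⟩
    · simp only [φ]
      rw [Finset.sum_eq_single (j N), h1, one_mul]
      · intro b _ hb
        rw [h2 N b hb, zero_mul]
      · intro h; exact absurd (Finset.mem_univ _) h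
    · obtain ⟨i, rfl⟩ := he s
      rw [tendsto_iff_dist_tendsto_zero]
      have hz : Tendsto (fun N : ℕ => 1 / ((N + 1 : ℕ) : ℝ)) atTop (nhds 0) := by
        simpa using tendsto_one_div_add_atTop_nhds_zero_nat (𝕜 := ℝ)
      refine squeeze_zero' (Eventually.of_forall fun _ => dist_nonneg) ?_ hz
      filter_upwards [eventually_ge_atTop i] with N hN
      exact h4 N ⟨i, Nat.lt_succ_of_le hN⟩
  let ψ : ℕ → Ω → ℝ := fun N ω => max (φ N ω - hp lam act π V D (μω ω)) 0
  have hhi := Di.int_hp hs hlam hD t0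
  have hψi : ∀ N, Integrable (ψ N) m := fun N => ((hφi N).sub hhi).pos_part
  have hψ0 : ∀ᵐ ω ∂m, Tendsto (fun N => ψ N ω) atTop (nhds 0) := by
    filter_upwards [hφ2] with ω ⟨ν', hν, h1, h2⟩
    have hbb : ∀ z : ℕ × KT G, Tendsto (fun N => bb lam act π V (ν' N) (D z.1) z.2) atTop
        (nhds (bb lam act π V (μω ω) (D z.1) z.2)) := by
      intro z
      refine bb_tendsto (fun S k v => ?_) (fun k v => ?_) _
      · exact h2 (Sum.inl ⟨(z.1, S, k), v⟩)
      · exact h2 (Sum.inr ⟨k, v⟩)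
    rw [Metric.tendsto_atTop]
    intro ε hε
    obtain ⟨z, hz⟩ : ∃ z : ℕ × KT G, bb lam act π V (μω ω) (D z.1) z.2 < hp lam act π V D (μω ω) + ε :=
      exists_lt_of_ciInf_lt (lt_add_of_pos_right _ hε)
    obtain ⟨N0, hN0⟩ := eventually_atTop.1 ((hbb z).eventually_lt_const hz)
    refine ⟨N0, fun N hN => ?_⟩
    have h3 : φ N ω ≤ bb lam act π V (ν' N) (D z.1) z.2 := by
      rw [h1]; exact ciInf_le (hs.hp_bdd hlam hD _) z
    have h4 := hN0 N hN
    rw [Real.dist_eq, sub_zero, abs_of_nonneg (le_max_right _ _)]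
    exact max_lt (by linarith) hε
  have hψ : Tendsto (fun N => ∫ ω, ψ N ω ∂m) atTop (nhds 0) := by
    have := tendsto_integral_of_dominated_convergence (μ := m) (F := ψ) (f := fun _ => 0)
      (fun _ => Cb lam ι t0) (fun N => (hψi N).aestronglyMeasurable) (integrable_const _)
      (fun N => by
        filter_upwards [hφ2] with ω ⟨ν', hν, h1, h2⟩
        rw [Real.norm_eq_abs, abs_of_nonneg (le_max_right _ _)]
        have h3 := hs.hp_le_Cb hlam hD (ν' N) t0
        have h4 := hs.hp_nonneg hlam hD (μω ω)
        have h5 := hs.hp_nonneg hlam hD (ν' N)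
        refine max_le ?_ (h5.trans h3)
        rw [h1]; linarith) hψ0
    simpa using this
  have hlim : Tendsto (fun N => ∫ ω, hp lam act π V D (μω ω) ∂m + ∫ ω, ψ N ω ∂m) atTop
      (nhds (∫ ω, hp lam act π V D (μω ω) ∂m + 0)) := tendsto_const_nhds.add hψ
  rw [add_zero] at hlim
  refine ge_of_tendsto' hlim fun N => (hφ1 N).trans ?_
  rw [← integral_add hhi (hψi N)]
  refine integral_mono (hφi N) (hhi.add (hψi N)) fun ω => ?_
  have := le_max_left (φ N ω - hp lam act π V D (μω ω)) 0
  simp only [ψ]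
  linarith

end Fin

end AscPf

theorem statement12 {G X Y : Type*} [Group G] [DecidableEq G] [Countable G] [Infinite G]
    [MetricSpace X] [CompactSpace X] [MeasurableSpace X] [BorelSpace X]
    [MetricSpace Y] [CompactSpace Y] [MeasurableSpace Y] [BorelSpace Y]
    (act : G → X → X) (hactc : ∀ g : G, Continuous (act g))
    (hact1 : ∀ x : X, act 1 x = x)
    (hactm : ∀ g h : G, ∀ x : X, act (g * h) x = act g (act h x))
    (actY : G → Y → Y) (hactYc : ∀ g : G, Continuous (actY g))
    (hactY1 : ∀ y : Y, actY 1 y = y)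
    (hactYm : ∀ g h : G, ∀ y : Y, actY (g * h) y = actY g (actY h y))
    (π : X → Y) (hπc : Continuous π) (hπs : Function.Surjective π)
    (hfac : ∀ (g : G) (x : X), π (act g x) = actY g (π x))
    (F : ℕ → Finset G) (hF : IsFolner F)
    (lam : Measure ℝ) (hlam : IsCoeffMeasure lam)
    (μ : Measure X) (hμ : IsProbabilityMeasure μ)
    (hinv : ∀ g : G, Measure.map (act g) μ = μ)
    (U : Finset (Set X)) (hUc : IsCover U) (hUm : ∀ A ∈ U, MeasurableSet A)
    (Ω : Type*) [MeasurableSpace Ω] (m : Measure Ω) (hm : IsProbabilityMeasure m)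
    (μω : Ω → Measure X) (hprob : ∀ ω, IsProbabilityMeasure (μω ω))
    (herg : ∀ ω, IsErgodicAct act (μω ω))
    (hmeas : ∀ B : Set X, MeasurableSet B → Measurable fun ω => μω ω B)
    (hdis : ∀ B : Set X, MeasurableSet B → μ B = ∫⁻ ω, μω ω B ∂m) :
    AscCondPlus μ π (coeff lam) act U F =
      ∫ ω, AscCondPlus (μω ω) π (coeff lam) act U F ∂m := by
  have hs : AscPf.Sys act actY π (MeasurableSpace.natGeneratingSequence Y) :=
    { hact := fun g => (hactc g).measurable
      hact1 := hact1
      hactm := hactm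
      hactY := fun g => (hactYc g).measurable
      hactY1 := hactY1
      hactYm := hactYm
      hπ := hπc.measurable
      hfac := hfac
      hgen := MeasurableSpace.generateFrom_natGeneratingSequence Y }
  have Di : AscPf.Dis m μ μω := ⟨hm, hμ, hprob, hmeas, hdis⟩
  have hcov : ∀ x : X, ∃ i : U, x ∈ (i : Set X) := by
    intro x
    have h : x ∈ ⋃₀ (U : Set (Set X)) := by rw [hUc]; trivial
    obtain ⟨A, hA, hx⟩ := h
    exact ⟨⟨A, hA⟩, hx⟩
  have hXne : Nonempty X := nonempty_of_isProbabilityMeasure μ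
  have hUne : Nonempty U := ⟨(hcov (Classical.arbitrary X)).choose⟩
  obtain ⟨D, hD⟩ := AscPf.exists_dense (W := fun i : U => (i : Set X)) (fun i => hUm _ i.2) hcov
  have hD' : AscPf.IsDense (fun i : U => (i : Set X)) D := hD
  have hne : Nonempty (AscPf.KT G) := ⟨(⟨F 0, hF.1 0⟩, 0)⟩
  rw [hs.plus_eq hlam hD' μ hinv hF]
  have h2 : ∀ ω, AscCondPlus (μω ω) π (coeff lam) act U F =
      AscPf.hp lam act π (MeasurableSpace.natGeneratingSequence Y) D (μω ω) := fun ω =>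
    hs.plus_eq hlam hD' (μω ω) (herg ω).1 hF
  simp_rw [h2]
  exact le_antisymm (AscPf.upper_final Di hs hlam hinv herg hF hD') (Di.lower hs hlam hD')
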